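/- arXiv:math/0409233 — 2 statements merged into one kernel-verified Lean document; each statement's English description precedes it below -/
import Mathlib

section
/- Let r be a real number with 0 < r ≤ 1 and let 𝒮_r denote the set of 2×2 real matrices A with positive coefficients such that each element of the first row of A is at least r times the corresponding element of the second row, and each element of the first column is at least r times the corresponding element of the second column. Then 𝒮_r is closed under matrix multiplication, and for all A, A' ∈ 𝒮_r one has ‖AA'‖ > r·‖A‖·‖A'‖. -/
open Matrix

/-- 2×2 integer matrices. -/
abbrev M2 : Type := Matrix (Fin 2) (Fin 2) ℤ

/-- The content of an integer matrix: the gcd of its coefficients. -/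
def content (A : M2) : ℕ :=
  Nat.gcd (Nat.gcd (A 0 0).natAbs (A 0 1).natAbs) (Nat.gcd (A 1 0).natAbs (A 1 1).natAbs)

/-- A matrix is primitive if its content is 1. -/
def Primitive (A : M2) : Prop := content A = 1

/-- Membership in 𝒫: primitive with nonzero determinant. -/
def MemP (A : M2) : Prop := Primitive A ∧ A.det ≠ 0

/-- `A^red`: the primitive matrix such that `A = content A • A^red`. -/
def red (A : M2) : M2 := Matrix.of fun i j => A i j / (content A : ℤ)

/-- The group operation of 𝒫: `A * B = (AB)^red`. -/
def pmul (A B : M2) : M2 := red (A * B)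

/-- A Fibonacci sequence in 𝒫 (indices from 1). -/
def IsFibP (W : ℕ → M2) : Prop :=
  (∀ i, 1 ≤ i → MemP (W i)) ∧ ∀ i, 1 ≤ i → W (i + 2) = pmul (W (i + 1)) (W i)

/-- Admissibility of a Fibonacci sequence in 𝒫: there is a non-symmetric,
non-skew-symmetric N ∈ 𝒫 such that W_i N_i is symmetric for all i ≥ 1,
where N_i = ᵗN for odd i and N_i = N for even i. -/
def AdmissibleFib (W : ℕ → M2) : Prop :=
  ∃ N : M2, MemP N ∧ N ≠ Nᵀ ∧ N ≠ -Nᵀ ∧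
    ∀ i, 1 ≤ i → (W i * (if i % 2 = 1 then Nᵀ else N)).IsSymm

/-- The norm of an integer 2×2 matrix: max absolute value of coefficients, as a real. -/
noncomputable def mnorm (A : M2) : ℝ :=
  max (max |(A 0 0 : ℝ)| |(A 0 1 : ℝ)|) (max |(A 1 0 : ℝ)| |(A 1 1 : ℝ)|)

/-- The sequence is unbounded in norm. -/
def UnboundedSeq (W : ℕ → M2) : Prop := ∀ C : ℝ, ∃ i, 1 ≤ i ∧ C < mnorm (W i)

/-- The golden ratio γ = (1+√5)/2. -/
noncomputable def gam : ℝ := (1 + Real.sqrt 5) / 2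

/-- Norm of the row vector (ξ, -1)·A. -/
noncomputable def xiNorm (ξ : ℝ) (A : M2) : ℝ :=
  max |ξ * (A 0 0 : ℝ) - (A 1 0 : ℝ)| |ξ * (A 0 1 : ℝ) - (A 1 1 : ℝ)|

/-- ξ is extremal: neither rational nor quadratic over ℚ, and for each X ≥ 1 the system
|x₀| ≤ X, |x₀ξ - x₁| ≤ c X^(-1/γ), |x₀ξ² - x₂| ≤ c X^(-1/γ) has a nonzero integer solution. -/
def IsExtremal (ξ : ℝ) : Prop :=
  (∀ a b c : ℚ, ¬(a = 0 ∧ b = 0 ∧ c = 0) → (a : ℝ) * ξ ^ 2 + (b : ℝ) * ξ + (c : ℝ) ≠ 0) ∧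
  ∃ c : ℝ, 0 < c ∧ ∀ X : ℝ, 1 ≤ X → ∃ x₀ x₁ x₂ : ℤ,
    ¬(x₀ = 0 ∧ x₁ = 0 ∧ x₂ = 0) ∧ |(x₀ : ℝ)| ≤ X ∧
    |(x₀ : ℝ) * ξ - (x₁ : ℝ)| ≤ c * X ^ (-1 / gam) ∧
    |(x₀ : ℝ) * ξ ^ 2 - (x₂ : ℝ)| ≤ c * X ^ (-1 / gam)

/-- The Fibonacci sequence `W` in 𝒫 is associated to the extremal real number ξ:
it is an unbounded admissible Fibonacci sequence in 𝒫 with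
‖W_{i+1}‖ ≍ ‖W_i‖^γ, ‖(ξ,-1)W_i‖ ≍ ‖W_i‖⁻¹ and |det W_i| ≍ 1. -/
def IsAssociated (ξ : ℝ) (W : ℕ → M2) : Prop :=
  IsFibP W ∧ UnboundedSeq W ∧ AdmissibleFib W ∧
  ∃ c₁ c₂ c₃ c₄ c₅ c₆ : ℝ, 0 < c₁ ∧ 0 < c₂ ∧ 0 < c₃ ∧ 0 < c₄ ∧ 0 < c₅ ∧ 0 < c₆ ∧
    ∀ i, 1 ≤ i →
      c₁ * mnorm (W i) ^ gam ≤ mnorm (W (i + 1)) ∧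
      mnorm (W (i + 1)) ≤ c₂ * mnorm (W i) ^ gam ∧
      c₃ * (mnorm (W i))⁻¹ ≤ xiNorm ξ (W i) ∧
      xiNorm ξ (W i) ≤ c₄ * (mnorm (W i))⁻¹ ∧
      c₅ ≤ |((W i).det : ℝ)| ∧ |((W i).det : ℝ)| ≤ c₆

/-- Membership in GL₂(ℤ): integer matrix of determinant ±1. -/
def InGL2Z (A : M2) : Prop := A.det = 1 ∨ A.det = -1

/-- ξ is badly approximable: irrational and |ξ - p/q| > c/q² for all rationals p/q. -/
def BadlyApprox (ξ : ℝ) : Prop :=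
  Irrational ξ ∧ ∃ c : ℝ, 0 < c ∧ ∀ p q : ℤ, q ≠ 0 → c / (q : ℝ) ^ 2 < |ξ - (p : ℝ) / (q : ℝ)|

/-- Partial quotients of the continued fraction expansion: `cfA n ξ` is `aₙ`
where ξ = [a₀, a₁, a₂, …]. -/
noncomputable def cfA : ℕ → ℝ → ℤ
  | 0, ξ => ⌊ξ⌋
  | n + 1, ξ => cfA n (ξ - ⌊ξ⌋)⁻¹

/-- A Fibonacci sequence of words (indices from 1). -/
def FibWordSeq {α : Type} (w : ℕ → List α) : Prop := ∀ i, 1 ≤ i → w (i + 2) = w (i + 1) ++ w i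

/-- `b` (indexed from 1: the limit word is b₁b₂b₃…) is the infinite limit word of the
sequence of words `w`: every `w k` (k ≥ 2) is a prefix of it, and their lengths are unbounded. -/
def IsLimitWord {α : Type} (w : ℕ → List α) (b : ℕ → α) : Prop :=
  (∀ n : ℕ, ∃ k, 2 ≤ k ∧ n ≤ (w k).length) ∧
  ∀ k, 2 ≤ k → ∀ j, (h : j < (w k).length) → (w k).get ⟨j, h⟩ = b (j + 1)

/-- The Fibonacci sequence of words over the alphabet E = {a, b} (with `b = false`,
`a = true`): w₁ = b, w₂ = a, w_{k+2} = w_{k+1} w_k.  Its limit is f_{a,b}. -/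
def fw : ℕ → List Bool
  | 0 => []
  | 1 => [false]
  | 2 => [true]
  | n + 3 => fw (n + 2) ++ fw (n + 1)

/-- The prefix of length `i` of the infinite Fibonacci word `f_{a,b}`
(note `fw (i+2)` is a prefix of `f_{a,b}` of length ≥ i). -/
def fpref (i : ℕ) : List Bool := (fw (i + 2)).take i

/-- The monoid morphism Φ : E* → (𝒫, *) with Φ(b) = W₁, Φ(a) = W₂
(the letter `b` is `false` and `a` is `true`). -/
def PhiW (W1 W2 : M2) : List Bool → M2
  | [] => 1
  | x :: u => pmul (if x then W2 else W1) (PhiW W1 W2 u)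

/-- The set 𝒮₁ of real matrices (a b; c d) with a ≥ max{b,c} and min{b,c} ≥ d ≥ 0. -/
def S1 : Set (Matrix (Fin 2) (Fin 2) ℝ) :=
  {A | max (A 0 1) (A 1 0) ≤ A 0 0 ∧ A 1 1 ≤ min (A 0 1) (A 1 0) ∧ 0 ≤ A 1 1}

/-- The set 𝒮 = 𝒮₁ ∩ GL₂(ℤ), viewed as a set of integer matrices. -/
def Sset : Set M2 :=
  {A | (A.map (Int.cast : ℤ → ℝ)) ∈ S1 ∧ (A.det = 1 ∨ A.det = -1)}

/-- ξ is an extremal real number with an associated Fibonacci sequence in GL₂(ℤ). -/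
def HasGLAssoc (ξ : ℝ) : Prop :=
  IsExtremal ξ ∧ ∃ W : ℕ → M2, IsAssociated ξ W ∧ ∀ i, 1 ≤ i → InGL2Z (W i)

/-- ξ is an extremal real number with an associated Fibonacci sequence in 𝒮. -/
def HasSAssoc (ξ : ℝ) : Prop :=
  IsExtremal ξ ∧ ∃ W : ℕ → M2, IsAssociated ξ W ∧ ∀ i, 1 ≤ i → W i ∈ Sset

/-- The set 𝒮_r of real 2×2 matrices with positive coefficients whose first-row elements are
at least r times those of the second row and whose first-column elements are at least r times
those of the second column. -/
def Srset (r : ℝ) : Set (Matrix (Fin 2) (Fin 2) ℝ) :=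
  {A | (∀ i j, 0 < A i j) ∧ (∀ j, r * A 1 j ≤ A 0 j) ∧ (∀ i, r * A i 1 ≤ A i 0)}

/-- Norm of a real 2×2 matrix: max absolute value of coefficients. -/
noncomputable def rnorm (A : Matrix (Fin 2) (Fin 2) ℝ) : ℝ :=
  max (max |A 0 0| |A 0 1|) (max |A 1 0| |A 1 1|)

theorem abs_le_rnorm (A : Matrix (Fin 2) (Fin 2) ℝ) (i j : Fin 2) : |A i j| ≤ rnorm A := by
  fin_cases i <;> fin_cases j <;> simp [rnorm]

theorem exists_rnorm_eq_abs (A : Matrix (Fin 2) (Fin 2) ℝ) : ∃ i j, rnorm A = |A i j| := by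
  unfold rnorm
  rcases max_choice (max |A 0 0| |A 0 1|) (max |A 1 0| |A 1 1|) with h | h <;> rw [h]
  · rcases max_choice |A 0 0| |A 0 1| with h | h <;> exact ⟨_, _, h⟩
  · rcases max_choice |A 1 0| |A 1 1| with h | h <;> exact ⟨_, _, h⟩

theorem mul_mem_Srset {r : ℝ} {A B : Matrix (Fin 2) (Fin 2) ℝ} (hA : A ∈ Srset r)
    (hB : B ∈ Srset r) : A * B ∈ Srset r := by
  obtain ⟨hA0, hA1, -⟩ := hA
  obtain ⟨hB0, -, hB2⟩ := hB
  refine ⟨fun i j => ?_, fun j => ?_, fun i => ?_⟩ <;>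
    simp only [Matrix.mul_apply, Fin.sum_univ_two]
  · exact add_pos (mul_pos (hA0 _ _) (hB0 _ _)) (mul_pos (hA0 _ _) (hB0 _ _))
  · linarith [mul_le_mul_of_nonneg_right (hA1 0) (hB0 0 j).le,
      mul_le_mul_of_nonneg_right (hA1 1) (hB0 1 j).le]
  · linarith [mul_le_mul_of_nonneg_left (hB2 0) (hA0 i 0).le,
      mul_le_mul_of_nonneg_left (hB2 1) (hA0 i 1).le]

theorem mul_mul_lt_mul_apply_of_mem_Srset {r : ℝ} (hr1 : r ≤ 1)
    {A B : Matrix (Fin 2) (Fin 2) ℝ} (hA : A ∈ Srset r) (hB : B ∈ Srset r) (i k l j : Fin 2) :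
    r * A i k * B l j < (A * B) i j := by
  obtain ⟨hA0, -, hA2⟩ := hA
  obtain ⟨hB0, hB1, -⟩ := hB
  have h0 := mul_pos (hA0 i 0) (hB0 0 j)
  have h1 := mul_pos (hA0 i 1) (hB0 1 j)
  rw [Matrix.mul_apply, Fin.sum_univ_two]
  fin_cases k <;> fin_cases l <;> dsimp only [Fin.zero_eta, Fin.mk_one]
  · linarith [mul_le_mul_of_nonneg_right hr1 h0.le]
  · linarith [mul_le_mul_of_nonneg_left (hB1 j) (hA0 i 0).le]
  · linarith [mul_le_mul_of_nonneg_right (hA2 i) (hB0 0 j).le]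
  · linarith [mul_le_mul_of_nonneg_right hr1 h1.le]

/-- 𝒮_r is closed under multiplication and ‖AA'‖ > r‖A‖‖A'‖ for A, A' ∈ 𝒮_r. -/
theorem stmt18 (r : ℝ) (hr0 : 0 < r) (hr1 : r ≤ 1) :
    (∀ A B : Matrix (Fin 2) (Fin 2) ℝ, A ∈ Srset r → B ∈ Srset r → A * B ∈ Srset r) ∧
    (∀ A B : Matrix (Fin 2) (Fin 2) ℝ, A ∈ Srset r → B ∈ Srset r →
      r * rnorm A * rnorm B < rnorm (A * B)) := by
  refine ⟨fun A B hA hB => mul_mem_Srset hA hB, fun A B hA hB => ?_⟩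
  obtain ⟨i, k, hik⟩ := exists_rnorm_eq_abs A
  obtain ⟨l, j, hlj⟩ := exists_rnorm_eq_abs B
  rw [hik, hlj, abs_of_pos (hA.1 i k), abs_of_pos (hB.1 l j)]
  exact (mul_mul_lt_mul_apply_of_mem_Srset hr1 hA hB i k l j).trans_le
    ((le_abs_self _).trans (abs_le_rnorm _ i j))
end

section
/- Let m be a nonzero integer, put W₁ = (m m; m−1 m) and W₂ = (2m m; 2m−1 m), and let (W_i)_{i≥1} be the Fibonacci sequence in (𝒫,*) generated by W₁ and W₂ (so W_{i+2} = W_{i+1}*W_i). Then (W_i)_{i≥1} is associated to an extremal real number ξ which is badly approximable; moreover det W_i = m for every index i not divisible by 3 and det W_i = 1 for every index i divisible by 3; and if |m| is not the square of an integer, then no real number of the form (aξ+b)/(cξ+d) with (a b; c d) ∈ GL₂(ℚ) is an extremal real number having an associated Fibonacci sequence all of whose terms lie in GL₂(ℤ). -/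
open Matrix

/-! ### Contents and reduced matrices -/

lemma content_dvd (A : M2) (i j : Fin 2) : (content A : ℤ) ∣ A i j := by
  rw [Int.natCast_dvd]
  have h0 := Nat.gcd_dvd_left (Nat.gcd (A 0 0).natAbs (A 0 1).natAbs)
    (Nat.gcd (A 1 0).natAbs (A 1 1).natAbs)
  have h1 := Nat.gcd_dvd_right (Nat.gcd (A 0 0).natAbs (A 0 1).natAbs)
    (Nat.gcd (A 1 0).natAbs (A 1 1).natAbs)
  fin_cases i <;> fin_cases j
  · exact h0.trans (Nat.gcd_dvd_left _ _)
  · exact h0.trans (Nat.gcd_dvd_right _ _)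
  · exact h1.trans (Nat.gcd_dvd_left _ _)
  · exact h1.trans (Nat.gcd_dvd_right _ _)

lemma content_smul_red (A : M2) : (content A : ℤ) • red A = A := by
  ext i j
  simp only [red, Matrix.smul_apply, Matrix.of_apply, smul_eq_mul]
  exact Int.mul_ediv_cancel' (content_dvd A i j)

lemma content_smul (k : ℤ) (A : M2) : content (k • A) = k.natAbs * content A := by
  simp only [content, Matrix.smul_apply, smul_eq_mul, Int.natAbs_mul, Nat.gcd_mul_left]

lemma red_smul_of_primitive {k : ℤ} (hk : 0 < k) {A : M2} (hA : Primitive A) :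
    red (k • A) = A := by
  have hc : ((content (k • A) : ℕ) : ℤ) = k := by
    rw [content_smul, hA]; simp [abs_of_pos hk]
  ext i j
  simp only [red, Matrix.of_apply, hc, Matrix.smul_apply, smul_eq_mul]
  exact Int.mul_ediv_cancel_left _ hk.ne'

lemma abs_entry_le_mnorm (A : M2) (i j : Fin 2) : |(A i j : ℝ)| ≤ mnorm A := by
  unfold mnorm
  fin_cases i <;> fin_cases j <;> simp

lemma mnorm_le {A : M2} {r : ℝ} (h : ∀ i j, |(A i j : ℝ)| ≤ r) : mnorm A ≤ r :=
  max_le (max_le (h 0 0) (h 0 1)) (max_le (h 1 0) (h 1 1))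

lemma mnorm_nonneg (A : M2) : 0 ≤ mnorm A :=
  (abs_nonneg _).trans (abs_entry_le_mnorm A 0 0)

lemma mnorm_transpose (A : M2) : mnorm Aᵀ = mnorm A :=
  le_antisymm (mnorm_le fun i j => abs_entry_le_mnorm A j i)
    (mnorm_le fun i j => abs_entry_le_mnorm Aᵀ j i)

lemma abs_mul_add_mul_le {x y z w a b : ℝ} (hx : |x| ≤ a) (hz : |z| ≤ a)
    (hy : |y| ≤ b) (hw : |w| ≤ b) : |x * y + z * w| ≤ 2 * a * b := by
  have ha : 0 ≤ a := (abs_nonneg x).trans hx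
  calc |x * y + z * w| ≤ |x| * |y| + |z| * |w| := by
        rw [← abs_mul, ← abs_mul]; exact abs_add_le _ _
    _ ≤ a * b + a * b := add_le_add (mul_le_mul hx hy (abs_nonneg _) ha)
        (mul_le_mul hz hw (abs_nonneg _) ha)
    _ = 2 * a * b := by ring

lemma mnorm_mul_le (A B : M2) : mnorm (A * B) ≤ 2 * mnorm A * mnorm B := by
  refine mnorm_le fun i j => ?_
  simp only [Matrix.mul_apply, Fin.sum_univ_two, Int.cast_add, Int.cast_mul]
  exact abs_mul_add_mul_le (abs_entry_le_mnorm _ _ _) (abs_entry_le_mnorm _ _ _)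
    (abs_entry_le_mnorm _ _ _) (abs_entry_le_mnorm _ _ _)

lemma mnorm_smul (k : ℤ) (A : M2) : mnorm (k • A) = |(k : ℝ)| * mnorm A := by
  simp only [mnorm, Matrix.smul_apply, smul_eq_mul, Int.cast_mul, abs_mul,
    mul_max_of_nonneg _ _ (abs_nonneg (k : ℝ))]

lemma one_le_mnorm {A : M2} (h : A.det ≠ 0) : 1 ≤ mnorm A := by
  by_contra hlt
  push Not at hlt
  have h0 : ∀ i j, A i j = 0 := fun i j => by
    have := (abs_entry_le_mnorm A i j).trans_lt hlt
    rw [← Int.cast_abs] at this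
    exact Int.abs_lt_one_iff.1 (by exact_mod_cast this)
  exact h (by rw [Matrix.det_fin_two]; simp [h0])

lemma xiNorm_nonneg (ξ : ℝ) (A : M2) : 0 ≤ xiNorm ξ A :=
  (abs_nonneg _).trans (le_max_left _ _)

lemma xiNorm_mul_le (ξ : ℝ) (A B : M2) : xiNorm ξ (A * B) ≤ 2 * xiNorm ξ A * mnorm B := by
  have key : ∀ j, |ξ * ((A * B) 0 j : ℝ) - ((A * B) 1 j : ℝ)| ≤ 2 * xiNorm ξ A * mnorm B := by
    intro j
    have : ξ * ((A * B) 0 j : ℝ) - ((A * B) 1 j : ℝ) =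
        (ξ * A 0 0 - A 1 0) * B 0 j + (ξ * A 0 1 - A 1 1) * B 1 j := by
      simp only [Matrix.mul_apply, Fin.sum_univ_two, Int.cast_add, Int.cast_mul]; ring
    rw [this]
    exact abs_mul_add_mul_le (le_max_left _ _) (le_max_right _ _)
      (abs_entry_le_mnorm _ _ _) (abs_entry_le_mnorm _ _ _)
  exact max_le (key 0) (key 1)

lemma abs_det_le (ξ : ℝ) (A : M2) : |(A.det : ℝ)| ≤ 2 * mnorm A * xiNorm ξ A := by
  have : (A.det : ℝ) = A 0 0 * -(ξ * A 0 1 - A 1 1) + A 0 1 * (ξ * A 0 0 - A 1 0) := by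
    rw [Matrix.det_fin_two]; push_cast; ring
  rw [this]
  exact abs_mul_add_mul_le (abs_entry_le_mnorm _ _ _) (abs_entry_le_mnorm _ _ _)
    (by rw [abs_neg]; exact le_max_right _ _) (le_max_left _ _)

/-! ### Symmetric matrices attached to an admissible Fibonacci sequence -/

/-- The determinant of three symmetric matrices in the coordinates `(x₀₀, x₀₁, x₁₁)`. -/
def det3 (x y z : M2) : ℤ :=
  x 0 0 * (y 0 1 * z 1 1 - y 1 1 * z 0 1) - x 0 1 * (y 0 0 * z 1 1 - y 1 1 * z 0 0) +
    x 1 1 * (y 0 0 * z 0 1 - y 0 1 * z 0 0)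

lemma det3_smul_eq {x W n z : M2} {k : ℤ} (hx : x.IsSymm) (hy : (W * n).IsSymm) (hz : z.IsSymm)
    (h : W * x = k • z) : k * det3 x (W * n) z = x.det * W.det * (n 0 1 - n 1 0) := by
  have hx' : x 1 0 = x 0 1 := hx.apply 0 1
  have hz' : z 1 0 = z 0 1 := hz.apply 0 1
  have hy' := hy.apply 0 1
  have e : ∀ i j, k * z i j = W i 0 * x 0 j + W i 1 * x 1 j := fun i j => by
    have := congrFun (congrFun h i) j
    simpa [Matrix.mul_apply, Fin.sum_univ_two, eq_comm] using this
  have e00 := e 0 0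
  have e01 := e 0 1
  have e10 := e 1 0
  have e11 := e 1 1
  simp only [Matrix.mul_apply, Fin.sum_univ_two] at hy'
  simp only [hx', hz'] at e00 e01 e10 e11
  have key : ∀ p q r s n0 n1 n2 n3 x0 x1 x2 : ℤ, p * n1 + q * n3 = r * n0 + s * n2 →
      p * x1 + q * x2 = r * x0 + s * x1 →
      x0 * ((p * n1 + q * n3) * (r * x1 + s * x2) - (r * n1 + s * n3) * (p * x1 + q * x2)) -
        x1 * ((p * n0 + q * n2) * (r * x1 + s * x2) - (r * n1 + s * n3) * (p * x0 + q * x1)) +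
        x2 * ((p * n0 + q * n2) * (p * x1 + q * x2) - (p * n1 + q * n3) * (p * x0 + q * x1)) =
      (x0 * x2 - x1 ^ 2) * (p * s - q * r) * (n1 - n2) := by
    intro p q r s n0 n1 n2 n3 x0 x1 x2 h1 h2
    grind
  have := key (W 0 0) (W 0 1) (W 1 0) (W 1 1) (n 0 0) (n 0 1) (n 1 0) (n 1 1)
    (x 0 0) (x 0 1) (x 1 1) hy'.symm (e01.symm.trans e10)
  rw [← e00, ← e01, ← e11] at this
  simp only [det3, Matrix.det_fin_two, Matrix.mul_apply, Fin.sum_univ_two, hx']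
  linear_combination this

lemma IsAssociated.exists_symm {ξ : ℝ} {W : ℕ → M2} (h : IsAssociated ξ W) :
    ∃ d : ℤ, d ≠ 0 ∧ ∃ x : ℕ → M2, ∃ D : ℝ, 1 ≤ D ∧ ∀ i, 1 ≤ i →
      (x i).IsSymm ∧ (x i).det = (W i).det * d ∧ mnorm (x i) ≤ D * mnorm (W i) ∧
      xiNorm ξ (x i) ≤ D * (mnorm (W i))⁻¹ ∧ det3 (x i) (x (i + 1)) (x (i + 2)) ≠ 0 := by
  obtain ⟨⟨hP, hrec⟩, -, ⟨N, hN, hN1, hN2, hsymm⟩, c₁, c₂, c₃, c₄, c₅, c₆, h1, h2, h3, h4, h5, h6,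
    hall⟩ := h
  set n : ℕ → M2 := fun i => if i % 2 = 1 then Nᵀ else N with hn
  have hndet : ∀ i, (n i).det = N.det := fun i => by
    simp only [hn]; split_ifs <;> simp
  have hnnorm : ∀ i, mnorm (n i) = mnorm N := fun i => by
    simp only [hn]; split_ifs <;> simp [mnorm_transpose]
  have hn2 : ∀ i, n (i + 2) = n i := fun i => by
    simp only [hn]; rw [Nat.add_mod_right]
  have hNs : ∀ i, n i 0 1 - n i 1 0 ≠ 0 := by
    have hne : N 0 1 - N 1 0 ≠ 0 := fun h0 => hN1 <| by
      ext i j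
      fin_cases i <;> fin_cases j <;> simp [Matrix.transpose_apply] <;> omega
    intro i
    simp only [hn]
    split_ifs
    · simp only [Matrix.transpose_apply]; omega
    · exact hne
  have hN0 : 1 ≤ mnorm N := one_le_mnorm hN.2
  refine ⟨N.det, hN.2, fun i => W i * n i, max 1 (max (2 * mnorm N) (2 * c₄ * mnorm N)),
    le_max_left _ _, fun i hi => ⟨hsymm i hi, ?_, ?_, ?_, ?_⟩⟩
  · rw [Matrix.det_mul, hndet]
  · calc mnorm (W i * n i) ≤ 2 * mnorm (W i) * mnorm (n i) := mnorm_mul_le _ _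
      _ = (2 * mnorm N) * mnorm (W i) := by rw [hnnorm]; ring
      _ ≤ _ := mul_le_mul_of_nonneg_right ((le_max_left _ _).trans (le_max_right _ _))
          (mnorm_nonneg _)
  · calc xiNorm ξ (W i * n i) ≤ 2 * xiNorm ξ (W i) * mnorm (n i) := xiNorm_mul_le _ _ _
      _ ≤ 2 * (c₄ * (mnorm (W i))⁻¹) * mnorm N := by
          rw [hnnorm]
          have := (hall i hi).2.2.2.1
          gcongr
      _ = (2 * c₄ * mnorm N) * (mnorm (W i))⁻¹ := by ring
      _ ≤ _ := mul_le_mul_of_nonneg_right ((le_max_right _ _).trans (le_max_right _ _))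
          (inv_nonneg.2 (mnorm_nonneg _))
  · have hk : W (i + 1) * (W i * n i) =
        (content (W (i + 1) * W i) : ℤ) • (W (i + 2) * n (i + 2)) := by
      rw [← Matrix.mul_assoc, hn2, ← Matrix.smul_mul, hrec i hi, pmul, content_smul_red]
    have := det3_smul_eq (hsymm i hi) (hsymm (i + 1) (by omega)) (hsymm (i + 2) (by omega)) hk
    intro h0
    change _ * det3 (W i * n i) (W (i + 1) * n (i + 1)) (W (i + 2) * n (i + 2)) = _ at this
    rw [h0, mul_zero, Matrix.det_mul, hndet] at this
    exact mul_ne_zero (mul_ne_zero (mul_ne_zero (hP i hi).2 hN.2) (hP (i + 1) (by omega)).2)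
      (hNs (i + 1)) this.symm
/-! ### Sequences growing like `Z (i + 1) ≍ Z i ^ γ` -/

lemma gam_mul_sub_one : gam * (gam - 1) = 1 := by
  have := Real.sq_sqrt (show (0 : ℝ) ≤ 5 by norm_num)
  unfold gam
  linear_combination this / 4

lemma one_lt_gam : 1 < gam := by
  have : (1 : ℝ) < Real.sqrt 5 := by
    rw [Real.lt_sqrt (by norm_num)]; norm_num
  unfold gam; linarith

lemma gam_lt_two : gam < 2 := by nlinarith [gam_mul_sub_one, one_lt_gam]

/-- `Z i ≥ 1` and `Z (i + 1) ≍ Z i ^ γ` with constant `E`, for `i ≥ 1`. -/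
def GamGrowth (Z : ℕ → ℝ) (E : ℝ) : Prop :=
  1 ≤ E ∧ ∀ i, 1 ≤ i → 1 ≤ Z i ∧ Z i ^ gam ≤ E * Z (i + 1) ∧ Z (i + 1) ≤ E * Z i ^ gam

lemma rpow_gam_eq {z : ℝ} (hz : 0 < z) : z ^ gam = z * z ^ (gam - 1) := by
  rw [Real.rpow_sub_one hz.ne']; field_simp

lemma rpow_gam_rpow {z : ℝ} (hz : 0 ≤ z) : (z ^ gam) ^ (gam - 1) = z := by
  rw [← Real.rpow_mul hz, gam_mul_sub_one, Real.rpow_one]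

lemma rpow_gam_sub_one_le {E : ℝ} (hE : 1 ≤ E) : E ^ (gam - 1) ≤ E :=
  calc E ^ (gam - 1) ≤ E ^ (1 : ℝ) :=
        Real.rpow_le_rpow_of_exponent_le hE (by linarith [gam_lt_two])
    _ = E := Real.rpow_one E

lemma GamGrowth.le_mul {Z : ℕ → ℝ} {E : ℝ} (h : GamGrowth Z E) {i : ℕ} (hi : 1 ≤ i) :
    Z (i + 2) ≤ E ^ 2 * (Z (i + 1) * Z i) := by
  obtain ⟨hE, h⟩ := h
  obtain ⟨hz, -, h1⟩ := h i hi
  obtain ⟨hz', -, h1'⟩ := h (i + 1) (by omega)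
  have hg : 0 ≤ gam - 1 := by linarith [one_lt_gam]
  have : Z (i + 1) ^ (gam - 1) ≤ E * Z i := by
    calc Z (i + 1) ^ (gam - 1) ≤ (E * Z i ^ gam) ^ (gam - 1) :=
          Real.rpow_le_rpow (by linarith) h1 hg
      _ = E ^ (gam - 1) * Z i := by
          rw [Real.mul_rpow (by linarith) (Real.rpow_nonneg (by linarith) _),
            rpow_gam_rpow (by linarith)]
      _ ≤ _ := mul_le_mul_of_nonneg_right (rpow_gam_sub_one_le hE) (by linarith)
  calc Z (i + 2) ≤ E * (Z (i + 1) * Z (i + 1) ^ (gam - 1)) := by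
        rw [← rpow_gam_eq (by linarith)]; exact h1'
    _ ≤ E * (Z (i + 1) * (E * Z i)) := by
        apply mul_le_mul_of_nonneg_left _ (by linarith)
        exact mul_le_mul_of_nonneg_left this (by linarith)
    _ = _ := by ring

lemma GamGrowth.eventually {Z : ℕ → ℝ} {E : ℝ} (h : GamGrowth Z E)
    (hu : ∀ C : ℝ, ∃ i, 1 ≤ i ∧ C < Z i) (M : ℝ) :
    ∃ i₀, 1 ≤ i₀ ∧ ∀ i, i₀ ≤ i → M ≤ Z i ∧ M * Z i ≤ Z (i + 1) := by
  obtain ⟨hE, h⟩ := h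
  set M' := max M 1
  have hM' : 1 ≤ M' := le_max_right _ _
  have hEM : 1 ≤ E * M' := one_le_mul_of_one_le_of_one_le hE hM'
  have hB : E * M' ≤ (E * M') ^ gam :=
    calc E * M' = (E * M') ^ (1 : ℝ) := (Real.rpow_one _).symm
      _ ≤ _ := Real.rpow_le_rpow_of_exponent_le hEM one_lt_gam.le
  have hg : 0 ≤ gam - 1 := by linarith [one_lt_gam]
  obtain ⟨i₀, hi₀, hlt⟩ := hu ((E * M') ^ gam)
  have step : ∀ i, 1 ≤ i → (E * M') ^ gam ≤ Z i → M' * Z i ≤ Z (i + 1) := by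
    intro i hi hZ
    obtain ⟨hz, h1, -⟩ := h i hi
    have h2 : E * M' ≤ Z i ^ (gam - 1) := by
      calc E * M' = ((E * M') ^ gam) ^ (gam - 1) := (rpow_gam_rpow (by linarith)).symm
        _ ≤ _ := Real.rpow_le_rpow (by linarith) hZ hg
    rw [rpow_gam_eq (by linarith)] at h1
    have h3 : Z i * (E * M') ≤ E * Z (i + 1) :=
      (mul_le_mul_of_nonneg_left h2 (by linarith)).trans h1
    have : E * (M' * Z i) ≤ E * Z (i + 1) := by linarith
    exact le_of_mul_le_mul_left this (by linarith)
  have hall : ∀ i, i₀ ≤ i → (E * M') ^ gam ≤ Z i := by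
    intro i hi
    induction i, hi using Nat.le_induction with
    | base => exact hlt.le
    | succ i hi ih =>
      have := step i (by omega) ih
      nlinarith [(h i (by omega)).1]
  refine ⟨i₀, hi₀, fun i hi => ?_⟩
  have h1 := hall i hi
  have h2 := step i (by omega) h1
  have h3 : M ≤ M' := le_max_left _ _
  have hz := (h i (by omega)).1
  constructor
  · nlinarith
  · exact (mul_le_mul_of_nonneg_right h3 (by linarith)).trans h2

lemma IsAssociated.gamGrowth {ξ : ℝ} {W : ℕ → M2} (h : IsAssociated ξ W) :
    ∃ E, GamGrowth (fun i => mnorm (W i)) E := by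
  obtain ⟨⟨hP, -⟩, -, -, c₁, c₂, c₃, c₄, c₅, c₆, h1, h2, h3, h4, h5, h6, hall⟩ := h
  refine ⟨max 1 (max c₁⁻¹ c₂), le_max_left _ _, fun i hi => ?_⟩
  obtain ⟨g1, g2, -⟩ := hall i hi
  have hz := one_le_mnorm (hP i hi).2
  have hz' := one_le_mnorm (hP (i + 1) (by omega)).2
  have hp := Real.rpow_nonneg (mnorm_nonneg (W i)) gam
  refine ⟨hz, ?_, ?_⟩
  · calc mnorm (W i) ^ gam = c₁⁻¹ * (c₁ * mnorm (W i) ^ gam) := by field_simp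
      _ ≤ c₁⁻¹ * mnorm (W (i + 1)) := by gcongr
      _ ≤ _ := mul_le_mul_of_nonneg_right ((le_max_left _ _).trans (le_max_right _ _))
          (by linarith)
  · exact g2.trans (mul_le_mul_of_nonneg_right ((le_max_right _ _).trans (le_max_right _ _)) hp)

/-! ### Extremality -/

lemma abs_sub_le_of_isSymm {ξ r : ℝ} {x : M2} (hx : x.IsSymm) (h : xiNorm ξ x ≤ r) :
    |ξ * x 0 0 - x 0 1| ≤ r ∧ |ξ * x 0 1 - x 1 1| ≤ r := by
  have hx' : x 1 0 = x 0 1 := hx.apply 0 1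
  rw [← hx']
  refine ⟨(le_max_left _ _).trans h, ?_⟩
  rw [hx']
  exact (le_max_right _ _).trans h

lemma IsAssociated.not_quadratic {ξ : ℝ} {W : ℕ → M2} (h : IsAssociated ξ W) (a b c : ℤ)
    (habc : ¬(a = 0 ∧ b = 0 ∧ c = 0)) : (a : ℝ) * ξ ^ 2 + b * ξ + c ≠ 0 := by
  intro h0
  obtain ⟨E, hE⟩ := h.gamGrowth
  obtain ⟨d, -, x, D, hD, hx⟩ := h.exists_symm
  set R : ℝ := (|(a : ℝ)| + |a * ξ + b|) * D with hR
  obtain ⟨i₀, hi₀, hlarge⟩ := hE.eventually h.2.1 (R + 1)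
  have hz : ∀ i, i₀ ≤ i → c * x i 0 0 + b * x i 0 1 + a * x i 1 1 = 0 := by
    intro i hi
    obtain ⟨hs, -, -, hxi, -⟩ := hx i (by omega)
    obtain ⟨h1, h2⟩ := abs_sub_le_of_isSymm hs hxi
    have hZ := (hlarge i hi).1
    have hZ1 := (hE.2 i (by omega)).1
    have : |((c * x i 0 0 + b * x i 0 1 + a * x i 1 1 : ℤ) : ℝ)| < 1 := by
      have e : ((c * x i 0 0 + b * x i 0 1 + a * x i 1 1 : ℤ) : ℝ) =
          -(a * (ξ * x i 0 1 - x i 1 1) + (a * ξ + b) * (ξ * x i 0 0 - x i 0 1)) := by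
        push_cast
        linear_combination (x i 0 0 : ℝ) * h0
      rw [e, abs_neg]
      calc _ ≤ |(a : ℝ)| * |ξ * x i 0 1 - x i 1 1| + |a * ξ + b| * |ξ * x i 0 0 - x i 0 1| := by
            rw [← abs_mul, ← abs_mul]; exact abs_add_le _ _
        _ ≤ |(a : ℝ)| * (D * (mnorm (W i))⁻¹) + |a * ξ + b| * (D * (mnorm (W i))⁻¹) := by
            gcongr
        _ = R / mnorm (W i) := by rw [hR]; ring
        _ < 1 := by rw [div_lt_one (by linarith)]; linarith
    rw [← Int.cast_abs] at this
    exact Int.abs_lt_one_iff.1 (by exact_mod_cast this)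
  have hdet := (hx i₀ hi₀).2.2.2.2
  have z0 := hz i₀ le_rfl
  have z1 := hz (i₀ + 1) (by omega)
  have z2 := hz (i₀ + 2) (by omega)
  generalize x i₀ = X at *
  generalize x (i₀ + 1) = Y at *
  generalize x (i₀ + 2) = T at *
  refine habc ⟨?_, ?_, ?_⟩ <;> refine (mul_eq_zero.1 (?_ : _ * det3 X Y T = 0)).resolve_right hdet
  · unfold det3
    linear_combination (Y 0 0 * T 0 1 - Y 0 1 * T 0 0) * z0 - (X 0 0 * T 0 1 - X 0 1 * T 0 0) * z1
      + (X 0 0 * Y 0 1 - X 0 1 * Y 0 0) * z2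
  · unfold det3
    linear_combination -(Y 0 0 * T 1 1 - Y 1 1 * T 0 0) * z0 + (X 0 0 * T 1 1 - X 1 1 * T 0 0) * z1
      - (X 0 0 * Y 1 1 - X 1 1 * Y 0 0) * z2
  · unfold det3
    linear_combination (Y 0 1 * T 1 1 - Y 1 1 * T 0 1) * z0 - (X 0 1 * T 1 1 - X 1 1 * T 0 1) * z1
      + (X 0 1 * Y 1 1 - X 1 1 * Y 0 1) * z2

theorem IsAssociated.isExtremal {ξ : ℝ} {W : ℕ → M2} (h : IsAssociated ξ W) : IsExtremal ξ := by
  constructor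
  · intro a b c habc h0
    have hden : ((a.den * b.den * c.den : ℕ) : ℝ) ≠ 0 := by
      have := a.den_pos; have := b.den_pos; have := c.den_pos
      positivity
    refine h.not_quadratic (a.num * b.den * c.den) (b.num * a.den * c.den)
      (c.num * a.den * b.den) ?_ ?_
    · simpa using habc
    · have ha : (a : ℝ) * a.den = a.num := by exact_mod_cast Rat.mul_den_eq_num a
      have hb : (b : ℝ) * b.den = b.num := by exact_mod_cast Rat.mul_den_eq_num b
      have hc : (c : ℝ) * c.den = c.num := by exact_mod_cast Rat.mul_den_eq_num c
      push_cast
      rw [← ha, ← hb, ← hc]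
      linear_combination (a.den * b.den * c.den : ℝ) * h0
  · obtain ⟨E, hE⟩ := h.gamGrowth
    obtain ⟨d, -, x, D, hD, hx⟩ := h.exists_symm
    have hg := one_lt_gam
    have hginv : 0 ≤ 1 / gam := by positivity
    have hE1 := hE.1
    set Z : ℕ → ℝ := fun i => mnorm (W i) with hZdef
    have hZ1 : 1 ≤ Z 1 := (hE.2 1 le_rfl).1
    set c₁ : ℝ := (D * Z 1) ^ (1 / gam) with hc₁
    set c₂ : ℝ := (1 + |ξ|) * D * (D * E) ^ (1 / gam) with hc₂
    have hc₁pos : 0 < c₁ := by positivity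
    have hc₂pos : 0 < c₂ := by positivity
    refine ⟨c₁ + c₂, by positivity, fun X hX => ?_⟩
    have hXpos : 0 < X ^ (-1 / gam) := by positivity
    have hXinv : X ^ (1 / gam) * X ^ (-1 / gam) = 1 := by
      rw [← Real.rpow_add (by linarith)]
      ring_nf
      exact Real.rpow_zero _
    have hex : ∃ i, 1 ≤ i ∧ X < D * Z i := by
      obtain ⟨i, hi, hlt⟩ := h.2.1 X
      exact ⟨i, hi, by nlinarith [(hE.2 i hi).1]⟩
    classical
    obtain ⟨hn1, hnX⟩ := Nat.find_spec hex
    set n := Nat.find hex with hn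
    have hmin : ∀ i, 1 ≤ i → i < n → D * Z i ≤ X := fun i hi hin => by
      have := Nat.find_min hex hin
      push Not at this
      exact this hi
    clear_value n
    rcases Nat.lt_or_ge 1 n with hlt | hle
    · obtain ⟨i, rfl⟩ : ∃ i, n = i + 1 := ⟨n - 1, by omega⟩
      have hi : 1 ≤ i := by omega
      obtain ⟨hs, -, hm, hxi, hd⟩ := hx i hi
      obtain ⟨h1, h2⟩ := abs_sub_le_of_isSymm hs hxi
      obtain ⟨hZi, -, hZ'⟩ := hE.2 i hi
      have hDZ := hmin i hi (by omega)
      have hXle : X ^ (1 / gam) ≤ (D * E) ^ (1 / gam) * Z i := by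
        calc X ^ (1 / gam) ≤ (D * E * Z i ^ gam) ^ (1 / gam) := by
              refine Real.rpow_le_rpow (by linarith) ?_ hginv
              calc X ≤ D * Z (i + 1) := hnX.le
                _ ≤ D * (E * Z i ^ gam) := by gcongr
                _ = _ := by ring
          _ = (D * E) ^ (1 / gam) * Z i := by
              rw [Real.mul_rpow (by positivity) (by positivity), ← Real.rpow_mul (by linarith),
                mul_one_div_cancel (by linarith), Real.rpow_one]
      have hinv : (Z i)⁻¹ ≤ (D * E) ^ (1 / gam) * X ^ (-1 / gam) := by
        rw [inv_le_iff_one_le_mul₀ (by linarith)]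
        calc 1 = X ^ (1 / gam) * X ^ (-1 / gam) := hXinv.symm
          _ ≤ (D * E) ^ (1 / gam) * Z i * X ^ (-1 / gam) := by gcongr
          _ = _ := by ring
      have hb : (1 + |ξ|) * (D * (Z i)⁻¹) ≤ (c₁ + c₂) * X ^ (-1 / gam) := by
        calc (1 + |ξ|) * (D * (Z i)⁻¹)
            ≤ (1 + |ξ|) * (D * ((D * E) ^ (1 / gam) * X ^ (-1 / gam))) := by gcongr
          _ = c₂ * X ^ (-1 / gam) := by rw [hc₂]; ring
          _ ≤ _ := by gcongr; linarith
      have hDi : 0 ≤ D * (Z i)⁻¹ := by positivity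
      refine ⟨x i 0 0, x i 0 1, x i 1 1, ?_, ?_, ?_, ?_⟩
      · rintro ⟨e0, e1, e2⟩
        exact hd (by simp [det3, e0, e1, e2])
      · exact (abs_entry_le_mnorm _ _ _).trans (hm.trans hDZ)
      · rw [mul_comm]
        refine h1.trans (le_trans ?_ hb)
        nlinarith [abs_nonneg ξ]
      · have e : (x i 0 0 : ℝ) * ξ ^ 2 - x i 1 1 =
            ξ * (ξ * x i 0 0 - x i 0 1) + (ξ * x i 0 1 - x i 1 1) := by ring
        rw [e]
        calc _ ≤ |ξ| * |ξ * x i 0 0 - x i 0 1| + |ξ * x i 0 1 - x i 1 1| := by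
              rw [← abs_mul]; exact abs_add_le _ _
          _ ≤ |ξ| * (D * (Z i)⁻¹) + D * (Z i)⁻¹ := by gcongr
          _ ≤ _ := by linarith
    · have hn' : n = 1 := by omega
      rw [hn'] at hnX
      refine ⟨0, 0, 1, by simp, by simp; linarith, ?_, ?_⟩
      · simp only [Int.cast_zero, zero_mul, sub_zero, abs_zero]; positivity
      · simp only [Int.cast_zero, zero_mul, zero_sub, Int.cast_one, abs_neg, abs_one]
        calc (1 : ℝ) = X ^ (1 / gam) * X ^ (-1 / gam) := hXinv.symm
          _ ≤ c₁ * X ^ (-1 / gam) := by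
              gcongr
              exact Real.rpow_le_rpow (by linarith) hnX.le hginv
          _ ≤ _ := by gcongr; linarith

lemma abs_det3_le {ξ r s t a b c : ℝ} {x y z : M2} (hx : x.IsSymm) (hy : y.IsSymm) (hz : z.IsSymm)
    (hxn : mnorm x ≤ a) (hyn : mnorm y ≤ b) (hzn : mnorm z ≤ c)
    (hxr : xiNorm ξ x ≤ r) (hyr : xiNorm ξ y ≤ s) (hzr : xiNorm ξ z ≤ t) :
    |(det3 x y z : ℝ)| ≤ 2 * (a * (s * t) + b * (r * t) + c * (r * s)) := by
  obtain ⟨x1, x2⟩ := abs_sub_le_of_isSymm hx hxr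
  obtain ⟨y1, y2⟩ := abs_sub_le_of_isSymm hy hyr
  obtain ⟨z1, z2⟩ := abs_sub_le_of_isSymm hz hzr
  have x0 := (abs_entry_le_mnorm x 0 0).trans hxn
  have y0 := (abs_entry_le_mnorm y 0 0).trans hyn
  have z0 := (abs_entry_le_mnorm z 0 0).trans hzn
  have e : (det3 x y z : ℝ) =
      x 0 0 * ((ξ * y 0 0 - y 0 1) * (ξ * z 0 1 - z 1 1) -
        (ξ * y 0 1 - y 1 1) * (ξ * z 0 0 - z 0 1)) -
      y 0 0 * ((ξ * x 0 0 - x 0 1) * (ξ * z 0 1 - z 1 1) -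
        (ξ * x 0 1 - x 1 1) * (ξ * z 0 0 - z 0 1)) +
      z 0 0 * ((ξ * x 0 0 - x 0 1) * (ξ * y 0 1 - y 1 1) -
        (ξ * x 0 1 - x 1 1) * (ξ * y 0 0 - y 0 1)) := by
    simp only [det3]; push_cast; ring
  have key : ∀ {p q p' q' u v k n : ℝ}, |p| ≤ u → |q| ≤ u → |p'| ≤ v → |q'| ≤ v → |k| ≤ n →
      |k * (p * q' - q * p')| ≤ n * (2 * (u * v)) := by
    intro p q p' q' u v k n hp hq hp' hq' hk
    have h1 := mul_le_mul hp hq' (abs_nonneg _) ((abs_nonneg _).trans hp)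
    have h2 := mul_le_mul hq hp' (abs_nonneg _) ((abs_nonneg _).trans hq)
    rw [abs_mul]
    refine mul_le_mul hk ?_ (abs_nonneg _) ((abs_nonneg _).trans hk)
    rw [← abs_mul] at h1 h2
    exact (abs_sub _ _).trans (by linarith)
  rw [e]
  have k1 := key y1 y2 z1 z2 x0
  have k2 := key x1 x2 z1 z2 y0
  have k3 := key x1 x2 y1 y2 z0
  refine (abs_add_le _ _).trans ?_
  refine (add_le_add ((abs_sub _ _).trans (add_le_add k1 k2)) k3).trans ?_
  linarith

/-- Two integer matrices, the second of which is a rational multiple of the first. -/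
def Linked (x y : M2) : Prop := ∃ k l : ℤ, k ≠ 0 ∧ k • y = l • x

lemma linked_of_det3_eq_zero {a b c y : M2} (hb : b.IsSymm) (hy : y.IsSymm) (h : det3 a b c ≠ 0)
    (h1 : det3 a b y = 0) (h2 : det3 b c y = 0) :
    Linked b y := by
  have hb' : b 1 0 = b 0 1 := hb.apply 0 1
  have hy' : y 1 0 = y 0 1 := hy.apply 0 1
  have h1' : det3 a b y * c 0 0 + det3 b c y * a 0 0 = 0 := by rw [h1, h2]; ring
  have h2' : det3 a b y * c 0 1 + det3 b c y * a 0 1 = 0 := by rw [h1, h2]; ring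
  have h4 : det3 a b y * c 1 1 + det3 b c y * a 1 1 = 0 := by rw [h1, h2]; ring
  refine ⟨det3 a b c, det3 a y c, h, ?_⟩
  simp only [det3] at h1' h2' h4 ⊢
  ext i j
  fin_cases i <;> fin_cases j <;>
    simp only [Matrix.smul_apply, smul_eq_mul, Fin.zero_eta, Fin.mk_one, hb', hy']
  · linear_combination h1'
  · linear_combination h2'
  · linear_combination h2'
  · linear_combination h4

/-- Symmetric integer matrices of bounded nonzero determinant approximating `(1, ξ, ξ²)`, with
norms controlled by `Z`. -/
structure SymSeq (ξ : ℝ) (x : ℕ → M2) (Z : ℕ → ℝ) (D B E : ℝ) : Prop where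
  growth : GamGrowth Z E
  unbounded : ∀ C : ℝ, ∃ i, 1 ≤ i ∧ C < Z i
  one_le_D : 1 ≤ D
  one_le_B : 1 ≤ B
  symm : ∀ i, 1 ≤ i → (x i).IsSymm
  mnorm_le : ∀ i, 1 ≤ i → mnorm (x i) ≤ D * Z i
  xiNorm_le : ∀ i, 1 ≤ i → xiNorm ξ (x i) ≤ D * (Z i)⁻¹
  det_ne : ∀ i, 1 ≤ i → (x i).det ≠ 0
  det_le : ∀ i, 1 ≤ i → |((x i).det : ℝ)| ≤ B

lemma det3_eq_zero_of_small {ξ D K : ℝ} {x y z : M2} {a b c : ℝ}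
    (hx : x.IsSymm) (hy : y.IsSymm) (hz : z.IsSymm) (ha : 1 ≤ a) (hb : 1 ≤ b) (hc : 1 ≤ c)
    (hxn : mnorm x ≤ D * a) (hyn : mnorm y ≤ D * b) (hzn : mnorm z ≤ D * c)
    (hxr : xiNorm ξ x ≤ D * a⁻¹) (hyr : xiNorm ξ y ≤ D * b⁻¹) (hzr : xiNorm ξ z ≤ D * c⁻¹)
    {G : ℝ} (hD : 1 ≤ D) (hK : 6 * D ^ 3 * G < K) (h1 : K * a ≤ G * (b * c))
    (h2 : K * b ≤ G * (a * c)) (h3 : K * c ≤ G * (a * b)) (hG : 0 ≤ G) : det3 x y z = 0 := by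
  have hKpos : 0 < K := lt_of_le_of_lt (by positivity) hK
  have hle := abs_det3_le hx hy hz hxn hyn hzn hxr hyr hzr
  have key : ∀ {u v w : ℝ}, 1 ≤ v → 1 ≤ w → K * u ≤ G * (v * w) →
      D * u * (D * v⁻¹ * (D * w⁻¹)) ≤ D ^ 3 * (G / K) := by
    intro u v w hv hw h
    have : D * u * (D * v⁻¹ * (D * w⁻¹)) = D ^ 3 * (u / (v * w)) := by field_simp
    rw [this]
    refine mul_le_mul_of_nonneg_left ?_ (by positivity)
    rw [div_le_div_iff₀ (by positivity) hKpos]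
    linarith
  have k1 := key hb hc h1
  have k2 := key ha hc h2
  have k3 := key ha hb h3
  have : D ^ 3 * (G / K) * 6 < 1 := by
    rw [← mul_div_assoc, div_mul_eq_mul_div, div_lt_one hKpos]; linarith
  have hlt : |(det3 x y z : ℝ)| < 1 := by linarith
  rw [← Int.cast_abs] at hlt
  have : |det3 x y z| < 1 := by exact_mod_cast hlt
  exact Int.abs_lt_one_iff.mp this

lemma SymSeq.exists_linked {ξ D B E : ℝ} {x : ℕ → M2} {Z : ℕ → ℝ} (h : SymSeq ξ x Z D B E)
    (hx : ∀ i, 1 ≤ i → det3 (x i) (x (i + 1)) (x (i + 2)) ≠ 0) :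
    ∃ K i₀, 1 ≤ K ∧ 1 ≤ i₀ ∧ ∀ i, i₀ ≤ i → ∀ (y : M2) (z : ℝ), y.IsSymm → 1 ≤ z →
      mnorm y ≤ D * z → xiNorm ξ y ≤ D * z⁻¹ → K * Z i ≤ z → K * z ≤ Z (i + 2) →
      Linked (x (i + 1)) y := by
  have hD := h.one_le_D
  have hE := h.growth.1
  obtain ⟨i₀, hi₀, hmono⟩ := h.growth.eventually h.unbounded 1
  have hK1 : 1 ≤ 6 * D ^ 3 * E ^ 2 + 1 := by
    have : 0 ≤ 6 * D ^ 3 * E ^ 2 := by positivity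
    linarith
  refine ⟨6 * D ^ 3 * E ^ 2 + 1, i₀ + 1, hK1, by omega, ?_⟩
  intro i hi y z hy hz hyn hyr hK hK'
  obtain ⟨i, rfl⟩ : ∃ k, i = k + 1 := ⟨i - 1, by omega⟩
  set K : ℝ := 6 * D ^ 3 * E ^ 2 + 1 with hKdef
  have hKlt : 6 * D ^ 3 * E ^ 2 < K := by linarith
  have p0 := (h.growth.2 i (by omega)).1
  have p1 := (h.growth.2 (i + 1) (by omega)).1
  have p2 := (h.growth.2 (i + 2) (by omega)).1
  have p3 := (h.growth.2 (i + 3) (by omega)).1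
  have m0 := (hmono i (by omega)).2
  have m2 := (hmono (i + 2) (by omega)).2
  have l0 := h.growth.le_mul (i := i) (by omega)
  have l1 := h.growth.le_mul (i := i + 1) (by omega)
  rw [one_mul] at m0 m2
  simp only [add_assoc, Nat.reduceAdd] at *
  have hE2 : 1 ≤ E ^ 2 := one_le_pow₀ hE
  refine linked_of_det3_eq_zero (h.symm _ (by omega)) hy (hx (i + 1) (by omega)) ?_ ?_
  · refine det3_eq_zero_of_small (h.symm _ (by omega)) (h.symm _ (by omega)) hy p1 p2 hz
      (h.mnorm_le _ (by omega)) (h.mnorm_le _ (by omega)) hyn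
      (h.xiNorm_le _ (by omega)) (h.xiNorm_le _ (by omega)) hyr hD hKlt ?_ ?_ ?_ (by positivity)
    · calc K * Z (i + 1) ≤ 1 * (1 * z) := by linarith
        _ ≤ E ^ 2 * (Z (i + 2) * z) := by gcongr
    · calc K * Z (i + 2) ≤ K * (E ^ 2 * (Z (i + 1) * Z i)) := by gcongr
        _ = E ^ 2 * (Z i * (K * Z (i + 1))) := by ring
        _ ≤ E ^ 2 * (Z (i + 1) * z) := by gcongr
    · calc K * z ≤ E ^ 2 * (Z (i + 2) * Z (i + 1)) := hK'.trans l1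
        _ = _ := by ring
  · refine det3_eq_zero_of_small (h.symm _ (by omega)) (h.symm _ (by omega)) hy p2 p3 hz
      (h.mnorm_le _ (by omega)) (h.mnorm_le _ (by omega)) hyn
      (h.xiNorm_le _ (by omega)) (h.xiNorm_le _ (by omega)) hyr hD hKlt ?_ ?_ ?_ (by positivity)
    · calc K * Z (i + 2) ≤ K * Z (i + 3) := by gcongr
        _ = 1 * (Z (i + 3) * (K * 1)) := by ring
        _ ≤ E ^ 2 * (Z (i + 3) * z) := by
          gcongr
          exact le_trans (by gcongr) hK
    · calc K * Z (i + 3) ≤ K * (E ^ 2 * (Z (i + 2) * Z (i + 1))) := by gcongr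
        _ = E ^ 2 * (Z (i + 2) * (K * Z (i + 1))) := by ring
        _ ≤ E ^ 2 * (Z (i + 2) * z) := by gcongr
    · calc K * z ≤ 1 * (1 * Z (i + 3)) := by linarith
        _ ≤ E ^ 2 * (Z (i + 2) * Z (i + 3)) := by gcongr

lemma Linked.le_mul {ξ D B z w : ℝ} {x y : M2} (h : Linked x y) (hD : 1 ≤ D) (hB : 1 ≤ B)
    (hz : 1 ≤ z) (hw : 1 ≤ w) (hx : x.det ≠ 0) (hy : y.det ≠ 0) (hxB : |(x.det : ℝ)| ≤ B)
    (hyB : |(y.det : ℝ)| ≤ B) (hxn : mnorm x ≤ D * z) (hyn : mnorm y ≤ D * w)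
    (hxr : xiNorm ξ x ≤ D * z⁻¹) (hyr : xiNorm ξ y ≤ D * w⁻¹) :
    z ≤ 2 * D ^ 2 * B * w ∧ w ≤ 2 * D ^ 2 * B * z := by
  obtain ⟨k, l, hk, hkl⟩ := h
  have hdet : k ^ 2 * y.det = l ^ 2 * x.det := by
    have := congrArg Matrix.det hkl
    rwa [Matrix.det_smul, Matrix.det_smul, Fintype.card_fin] at this
  have hl : l ≠ 0 := by
    rintro rfl
    have : k ^ 2 * y.det = 0 := by rw [hdet]; ring
    simp_all
  have hnorm : |(k : ℝ)| * mnorm y = |(l : ℝ)| * mnorm x := by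
    rw [← mnorm_smul, ← mnorm_smul, hkl]
  have one_le : ∀ {n : ℤ}, n ≠ 0 → 1 ≤ |(n : ℝ)| := fun {n} hn => by
    rw [← Int.cast_abs]; exact_mod_cast Int.one_le_abs hn
  have hsq : |(k : ℝ)| ^ 2 * |(y.det : ℝ)| = |(l : ℝ)| ^ 2 * |(x.det : ℝ)| := by
    rw [← abs_pow, ← abs_pow, ← abs_mul, ← abs_mul]; exact_mod_cast congrArg (|·|) hdet
  have aux : ∀ {k l a b z w : ℝ} {x y : M2}, 0 < k → 0 < l → 1 ≤ a → b ≤ B →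
      k ^ 2 * a = l ^ 2 * b → 1 ≤ z → 1 ≤ w → x.det ≠ 0 → xiNorm ξ x ≤ D * z⁻¹ →
      mnorm y ≤ D * w → k * mnorm y = l * mnorm x → z ≤ 2 * D ^ 2 * B * w := by
    intro k l a b z w x y hk hl ha hb hsq hz hw hx hxr hyn hn
    have hkl : k ≤ B * l := by
      refine le_of_sq_le_sq ?_ (by positivity)
      calc k ^ 2 ≤ k ^ 2 * a := le_mul_of_one_le_right (by positivity) ha
        _ ≤ l ^ 2 * B := by rw [hsq]; gcongr
        _ ≤ l ^ 2 * B ^ 2 := by gcongr; nlinarith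
        _ = (B * l) ^ 2 := by ring
    have h1 : z ≤ 2 * D * mnorm x := by
      have := (one_le hx).trans (abs_det_le ξ x)
      have h2 : 2 * mnorm x * xiNorm ξ x ≤ 2 * mnorm x * (D * z⁻¹) := by
        have := mnorm_nonneg x; gcongr
      have h3 : 1 ≤ 2 * D * mnorm x / z := by
        refine (this.trans h2).trans (le_of_eq ?_); field_simp
      rwa [one_le_div (by linarith)] at h3
    have h2 : l * mnorm x ≤ l * (B * (D * w)) := by
      rw [← hn]
      calc k * mnorm y ≤ B * l * (D * w) := by
            have := mnorm_nonneg y; gcongr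
        _ = _ := by ring
    have h3 := le_of_mul_le_mul_left h2 hl
    calc z ≤ 2 * D * (B * (D * w)) := h1.trans (by gcongr)
      _ = _ := by ring
  have hk' : 0 < |(k : ℝ)| := by positivity
  have hl' : 0 < |(l : ℝ)| := by positivity
  exact ⟨aux hk' hl' (one_le hy) hxB hsq hz hw hx hxr hyn hnorm,
    aux hl' hk' (one_le hx) hyB hsq.symm hw hz hy hyr hxn hnorm.symm⟩

lemma le_two_rpow_gam {F : ℝ} (hF : 1 ≤ F) : F ^ gam ≤ F ^ 2 := by
  rw [← Real.rpow_natCast F 2]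
  exact Real.rpow_le_rpow_of_exponent_le hF (by exact_mod_cast gam_lt_two.le)

lemma SymSeq.exists_shift_linked {ξ D B E : ℝ} {x y : ℕ → M2} {Z w : ℕ → ℝ}
    (h : SymSeq ξ x Z D B E) (h' : SymSeq ξ y w D B E)
    (hx : ∀ i, 1 ≤ i → det3 (x i) (x (i + 1)) (x (i + 2)) ≠ 0) :
    ∃ i j, 1 ≤ i ∧ 1 ≤ j ∧ ∀ t, Linked (x (i + t)) (y (j + t)) := by
  obtain ⟨K, i₀, hK, hi₀, hlink⟩ := h.exists_linked hx
  have hD := h.one_le_D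
  have hB := h.one_le_B
  have hE := h.growth.1
  set F : ℝ := 2 * D ^ 2 * B with hFdef
  have hF : 1 ≤ F := by
    have : 1 ≤ D ^ 2 * B := one_le_mul_of_one_le_of_one_le (one_le_pow₀ hD) hB
    linarith
  set M : ℝ := max (K * K) (K * E ^ 2 * F ^ 2) with hMdef
  have hKM : K ≤ M := le_trans (le_mul_of_one_le_right (by linarith) hK) (le_max_left _ _)
  have hKF : K * F ≤ M := by
    refine le_trans ?_ (le_max_right _ _)
    calc K * F = K * 1 * F := by ring
      _ ≤ K * E ^ 2 * F ^ 2 := by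
        gcongr
        · exact one_le_pow₀ hE
        · exact le_self_pow₀ hF two_ne_zero
  have hM1 : 1 ≤ M := hK.trans hKM
  obtain ⟨i₁, hi₁, hZ⟩ := h.growth.eventually h.unbounded M
  obtain ⟨j₁, hj₁, hw⟩ := h'.growth.eventually h'.unbounded M
  have hZ1 : ∀ i, 1 ≤ i → 1 ≤ Z i := fun i hi => (h.growth.2 i hi).1
  have hw1 : ∀ i, 1 ≤ i → 1 ≤ w i := fun i hi => (h'.growth.2 i hi).1
  have hlink' : ∀ i j, i₀ ≤ i → 1 ≤ j → K * Z i ≤ w j → K * w j ≤ Z (i + 2) →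
      Linked (x (i + 1)) (y j) := fun i j hi hj =>
    hlink i hi (y j) (w j) (h'.symm j hj) (hw1 j hj) (h'.mnorm_le j hj) (h'.xiNorm_le j hj)
  have step : ∀ i j, i₀ ≤ i → i₁ ≤ i → j₁ ≤ j → Linked (x i) (y j) →
      Linked (x (i + 1)) (y (j + 1)) := by
    intro i j hi0 hi1 hj1 hl
    obtain ⟨hle, hle'⟩ := hl.le_mul hD hB (hZ1 i (by omega)) (hw1 j (by omega))
      (h.det_ne _ (by omega)) (h'.det_ne _ (by omega)) (h.det_le _ (by omega))
      (h'.det_le _ (by omega)) (h.mnorm_le _ (by omega)) (h'.mnorm_le _ (by omega))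
      (h.xiNorm_le _ (by omega)) (h'.xiNorm_le _ (by omega))
    have hZi := hZ1 i (by omega)
    have hwj := hw1 j (by omega)
    refine hlink' i (j + 1) hi0 (by omega) ?_ ?_
    · calc K * Z i ≤ K * (F * w j) := by gcongr
        _ = K * F * w j := by ring
        _ ≤ M * w j := by gcongr
        _ ≤ _ := (hw j hj1).2
    · calc K * w (j + 1) ≤ K * (E * w j ^ gam) := by
            gcongr; exact (h'.growth.2 j (by omega)).2.2
        _ ≤ K * (E * (F * Z i) ^ gam) := by
            gcongr; linarith [one_lt_gam]
        _ = K * E * (F ^ gam * Z i ^ gam) := by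
            rw [Real.mul_rpow (by linarith) (by linarith)]; ring
        _ ≤ K * E * (F ^ 2 * (E * Z (i + 1))) := by
            gcongr
            · exact le_two_rpow_gam hF
            · exact (h.growth.2 i (by omega)).2.1
        _ = K * E ^ 2 * F ^ 2 * Z (i + 1) := by ring
        _ ≤ M * Z (i + 1) := by
            have := hZ1 (i + 1) (by omega)
            gcongr; exact le_max_right _ _
        _ ≤ _ := (hZ (i + 1) (by omega)).2
  obtain ⟨i, j, hi0, hi1, hj1, hl⟩ :
      ∃ i j, i₀ ≤ i ∧ i₁ ≤ i ∧ j₁ ≤ j ∧ Linked (x i) (y j) := by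
    set n := max i₀ i₁ + 1 with hn
    obtain ⟨j₂, hj₂, hbig⟩ := h'.growth.eventually h'.unbounded (Z n)
    set j := max j₁ j₂
    have hj : Z n ≤ w j := (hbig j (le_max_right _ _)).1
    have hex : ∃ k, n ≤ k ∧ w j < Z k := by
      obtain ⟨i₂, -, h2⟩ := h.growth.eventually h.unbounded (w j + 1)
      exact ⟨max n i₂, le_max_left _ _, by linarith [(h2 _ (le_max_right n i₂)).1]⟩
    classical
    obtain ⟨hk1, hk2⟩ := Nat.find_spec hex
    have hmin : ∀ i, n ≤ i → i < Nat.find hex → Z i ≤ w j := fun i hi hik => by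
      have := Nat.find_min hex hik
      push Not at this
      exact this hi
    generalize Nat.find hex = k at hk1 hk2 hmin
    have hkn : k ≠ n := by rintro rfl; linarith
    obtain ⟨k, rfl⟩ : ∃ l, k = l + 2 := ⟨k - 2, by omega⟩
    have hj1 : j₁ ≤ j := le_max_left _ _
    have hZk := hmin (k + 1) (by omega) (by omega)
    have hwj := hw1 j (by omega)
    rcases le_total (K * w j) (Z (k + 2)) with hc | hc
    · refine ⟨k + 1, j, by omega, by omega, hj1, hlink' k j (by omega) (by omega) ?_ hc⟩
      have := hZ1 k (by omega)
      calc K * Z k ≤ M * Z k := by gcongr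
        _ ≤ Z (k + 1) := (hZ k (by omega)).2
        _ ≤ w j := hZk
    · refine ⟨k + 2, j, by omega, by omega, hj1,
        hlink' (k + 1) j (by omega) (by omega) ?_ ?_⟩
      · have h1 := hZ1 (k + 1) (by omega)
        have hh := (hZ (k + 1) (by omega)).2
        have hstep : K * (K * Z (k + 1)) ≤ K * w j := by
          refine le_trans ?_ hc
          refine le_trans ?_ hh
          rw [← mul_assoc]
          gcongr
          exact le_max_left _ _
        exact le_of_mul_le_mul_left hstep (by linarith)
      · calc K * w j ≤ K * Z (k + 2) := by gcongr
          _ ≤ M * Z (k + 2) := by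
            have := hZ1 (k + 2) (by omega)
            gcongr
          _ ≤ _ := (hZ (k + 2) (by omega)).2
  refine ⟨i, j, by omega, by omega, fun t => ?_⟩
  induction t with
  | zero => exact hl
  | succ t ih => exact step (i + t) (j + t) (by omega) (by omega) (by omega) ih

lemma GamGrowth.mono {Z : ℕ → ℝ} {E E' : ℝ} (h : GamGrowth Z E) (hE : E ≤ E') : GamGrowth Z E' := by
  obtain ⟨h1, h⟩ := h
  refine ⟨h1.trans hE, fun i hi => ?_⟩
  obtain ⟨a, b, c⟩ := h i hi
  have h0 := (h (i + 1) (by omega)).1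
  exact ⟨a, b.trans (by gcongr), c.trans (by gcongr)⟩

lemma SymSeq.mono {ξ D B E D' B' E' : ℝ} {x : ℕ → M2} {Z : ℕ → ℝ} (h : SymSeq ξ x Z D B E)
    (hD : D ≤ D') (hB : B ≤ B') (hE : E ≤ E') : SymSeq ξ x Z D' B' E' where
  growth := h.growth.mono hE
  unbounded := h.unbounded
  one_le_D := h.one_le_D.trans hD
  one_le_B := h.one_le_B.trans hB
  symm := h.symm
  mnorm_le i hi := (h.mnorm_le i hi).trans <| by
    have := (h.growth.2 i hi).1; gcongr
  xiNorm_le i hi := (h.xiNorm_le i hi).trans <| by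
    have := (h.growth.2 i hi).1; gcongr
  det_ne := h.det_ne
  det_le i hi := (h.det_le i hi).trans hB

lemma SymSeq.congruence {ξ η D B E l : ℝ} {x : ℕ → M2} {Z : ℕ → ℝ} (h : SymSeq η x Z D B E)
    (P : M2) (hP : P.det ≠ 0) (h0 : ξ * P 0 0 - P 1 0 = l * η) (h1 : ξ * P 0 1 - P 1 1 = -l) :
    ∃ D' B', SymSeq ξ (fun i => P * x i * Pᵀ) Z D' B' E := by
  have hD := h.one_le_D
  have hB := h.one_le_B
  have hPn := one_le_mnorm hP
  set D' : ℝ := 4 * mnorm P ^ 2 * D + 2 * |l| * mnorm P * D with hD'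
  have hdet : ∀ i, (P * x i * Pᵀ).det = P.det ^ 2 * (x i).det := fun i => by
    rw [Matrix.det_mul, Matrix.det_mul, Matrix.det_transpose]; ring
  have one_le : 1 ≤ ((P.det : ℝ)) ^ 2 := by
    exact_mod_cast Int.one_le_abs (pow_ne_zero 2 hP) |>.trans (abs_of_nonneg (sq_nonneg _)).le
  refine ⟨D', (P.det : ℝ) ^ 2 * B, h.growth, h.unbounded, ?_, ?_, ?_, ?_, ?_, ?_, ?_⟩
  · have h2 : 1 ≤ mnorm P ^ 2 * D := one_le_mul_of_one_le_of_one_le (one_le_pow₀ hPn) hD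
    have h3 : 0 ≤ 2 * |l| * mnorm P * D := by positivity
    rw [hD']; linarith
  · exact one_le_mul_of_one_le_of_one_le one_le hB
  · intro i hi
    have := h.symm i hi
    simp only [Matrix.IsSymm, Matrix.transpose_mul, Matrix.transpose_transpose, Matrix.mul_assoc]
    rw [this]
  · intro i hi
    have hz := (h.growth.2 i hi).1
    calc mnorm (P * x i * Pᵀ) ≤ 2 * (2 * mnorm P * mnorm (x i)) * mnorm P := by
          refine (mnorm_mul_le _ _).trans ?_
          rw [mnorm_transpose]
          gcongr
          exact mnorm_mul_le _ _
      _ ≤ 2 * (2 * mnorm P * (D * Z i)) * mnorm P := by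
          gcongr; exact h.mnorm_le i hi
      _ = 4 * mnorm P ^ 2 * D * Z i := by ring
      _ ≤ D' * Z i := by
          gcongr
          rw [hD']
          exact le_add_of_nonneg_right (by positivity)
  · intro i hi
    have hz := (h.growth.2 i hi).1
    have e : xiNorm ξ (P * x i) = |l| * xiNorm η (x i) := by
      simp only [xiNorm, mul_max_of_nonneg _ _ (abs_nonneg l), ← abs_mul]
      congr 2
      · simp only [Matrix.mul_apply, Fin.sum_univ_two, Int.cast_add, Int.cast_mul]
        linear_combination (x i 0 0 : ℝ) * h0 + (x i 1 0 : ℝ) * h1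
      · simp only [Matrix.mul_apply, Fin.sum_univ_two, Int.cast_add, Int.cast_mul]
        linear_combination (x i 0 1 : ℝ) * h0 + (x i 1 1 : ℝ) * h1
    calc xiNorm ξ (P * x i * Pᵀ) ≤ 2 * (|l| * xiNorm η (x i)) * mnorm P := by
          refine (xiNorm_mul_le _ _ _).trans ?_
          rw [mnorm_transpose, e]
      _ ≤ 2 * (|l| * (D * (Z i)⁻¹)) * mnorm P := by
          gcongr; exact h.xiNorm_le i hi
      _ = 2 * |l| * mnorm P * D * (Z i)⁻¹ := by ring
      _ ≤ D' * (Z i)⁻¹ := by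
          gcongr
          rw [hD']
          exact le_add_of_nonneg_left (by positivity)
  · intro i hi
    rw [hdet]
    exact mul_ne_zero (pow_ne_zero 2 hP) (h.det_ne i hi)
  · intro i hi
    rw [hdet]
    rw [Int.cast_mul, Int.cast_pow, abs_mul, abs_of_nonneg (sq_nonneg (P.det : ℝ))]
    gcongr
    exact h.det_le i hi

lemma IsAssociated.exists_symSeq {ξ : ℝ} {W : ℕ → M2} (h : IsAssociated ξ W) :
    ∃ d : ℤ, d ≠ 0 ∧ ∃ (x : ℕ → M2) (D B E : ℝ), SymSeq ξ x (fun i => mnorm (W i)) D B E ∧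
      ∀ i, 1 ≤ i → (x i).det = (W i).det * d ∧ det3 (x i) (x (i + 1)) (x (i + 2)) ≠ 0 := by
  obtain ⟨d, hd, x, D, hD, hx⟩ := h.exists_symm
  obtain ⟨E, hE⟩ := h.gamGrowth
  obtain ⟨⟨hP, -⟩, hu, -, c₁, c₂, c₃, c₄, c₅, c₆, -, -, -, -, -, hc₆, hall⟩ := h
  refine ⟨d, hd, x, D, max 1 (c₆ * |(d : ℝ)|), E, ?_,
    fun i hi => ⟨(hx i hi).2.1, (hx i hi).2.2.2.2⟩⟩
  refine ⟨hE, hu, hD, le_max_left _ _, fun i hi => (hx i hi).1, fun i hi => (hx i hi).2.2.1,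
    fun i hi => (hx i hi).2.2.2.1, fun i hi => ?_, fun i hi => ?_⟩
  · rw [(hx i hi).2.1]
    exact mul_ne_zero (hP i hi).2 hd
  · rw [(hx i hi).2.1]
    rw [Int.cast_mul, abs_mul]
    refine le_trans ?_ (le_max_right _ _)
    gcongr
    exact (hall i hi).2.2.2.2.2

/-- The square classes of `det W_i` are eventually constant, up to sign, if `ξ` is conjugate to an
extremal number with an associated sequence in `GL₂(ℤ)`. -/
lemma IsAssociated.det_square_class {ξ η l : ℝ} {W V : ℕ → M2} (h : IsAssociated ξ W)
    (h' : IsAssociated η V) (hV : ∀ i, 1 ≤ i → InGL2Z (V i)) (P : M2) (hP : P.det ≠ 0)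
    (h0 : ξ * P 0 0 - P 1 0 = l * η) (h1 : ξ * P 0 1 - P 1 1 = -l) :
    ∃ i a b : ℤ, 1 ≤ i ∧ a ≠ 0 ∧ b ≠ 0 ∧ ∀ n : ℕ, i ≤ n →
      ∃ k l : ℤ, k ≠ 0 ∧ k ^ 2 * a = l ^ 2 * (|(W n).det| * b) := by
  obtain ⟨d, hd, x, D, B, E, hs, hx⟩ := h.exists_symSeq
  obtain ⟨d', hd', y, D', B', E', hs', hy⟩ := h'.exists_symSeq
  obtain ⟨D₂, B₂, hs₂⟩ := hs'.congruence P hP h0 h1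
  obtain ⟨i, j, hi, hj, hl⟩ :=
    (hs.mono (le_max_left D D₂) (le_max_left B B₂) (le_max_left E E')).exists_shift_linked
    (hs₂.mono (le_max_right D D₂) (le_max_right B B₂) (le_max_right E E')) fun i hi => (hx i hi).2
  refine ⟨i, P.det ^ 2 * |d'|, |d|, by exact_mod_cast hi,
    mul_ne_zero (pow_ne_zero 2 hP) (abs_ne_zero.mpr hd'), abs_ne_zero.mpr hd, fun n hn => ?_⟩
  obtain ⟨t, rfl⟩ := Nat.exists_eq_add_of_le (by exact_mod_cast hn : i ≤ n)
  obtain ⟨k, l, hk, hkl⟩ := hl t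
  refine ⟨k, l, hk, ?_⟩
  have hdet := congrArg (fun A => |Matrix.det A|) hkl
  have hVdet : |(V (j + t)).det| = 1 := by
    rcases hV (j + t) (by omega) with h | h <;> simp [h]
  simp only [Matrix.det_smul, Fintype.card_fin, Matrix.det_mul, Matrix.det_transpose,
    (hx (i + t) (by omega)).1, (hy (j + t) (by omega)).1, abs_mul, abs_pow, sq_abs, hVdet] at hdet
  rw [← hdet, ← sq_abs P.det]
  ring

lemma exists_sq_eq_of_sq_mul_eq {a b n : ℤ} (ha : a ≠ 0) (h : a ^ 2 * n = b ^ 2) :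
    ∃ c : ℤ, c * c = n := by
  obtain ⟨c, rfl⟩ := (Int.pow_dvd_pow_iff two_ne_zero).mp (Dvd.intro n h)
  refine ⟨c, mul_left_cancel₀ (pow_ne_zero 2 ha) ?_⟩
  rw [h]; ring

/-- A rational linear fractional transformation has an integer representative. -/
lemma exists_int_representative (A : Matrix (Fin 2) (Fin 2) ℚ) (hA : A.det ≠ 0) :
    ∃ (P : M2) (q : ℤ), q ≠ 0 ∧ P.det ≠ 0 ∧ (∀ i j, (P i j : ℝ) = q * (A i j : ℝ)) := by
  set q : ℕ := (A 0 0).den * (A 0 1).den * ((A 1 0).den * (A 1 1).den) with hq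
  have hq0 : q ≠ 0 := by simp [hq]
  have hdvd : ∀ i j, (A i j).den ∣ q := by
    intro i j
    fin_cases i <;> fin_cases j
    · exact Dvd.dvd.mul_right (Dvd.intro _ rfl) _
    · exact Dvd.dvd.mul_right (Dvd.intro_left _ rfl) _
    · exact Dvd.dvd.mul_left (Dvd.intro _ rfl) _
    · exact Dvd.dvd.mul_left (Dvd.intro_left _ rfl) _
  have hex : ∀ i j, ∃ n : ℤ, (n : ℚ) = q * A i j := by
    intro i j
    obtain ⟨r, hr⟩ := hdvd i j
    refine ⟨r * (A i j).num, ?_⟩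
    rw [hr]
    push_cast
    linear_combination -(r : ℚ) * Rat.mul_den_eq_num (A i j)
  choose P hP using hex
  refine ⟨Matrix.of P, q, by exact_mod_cast hq0, ?_, fun i j => ?_⟩
  · intro h0
    apply hA
    have : ((Matrix.of P).det : ℚ) = q ^ 2 * A.det := by
      rw [Matrix.det_fin_two, Matrix.det_fin_two]
      push_cast
      simp only [Matrix.of_apply, hP]
      ring
    rw [h0] at this
    simpa [hq0] using this.symm
  · have := hP i j
    simp only [Matrix.of_apply, Int.cast_natCast]
    exact_mod_cast congrArg (Rat.cast (K := ℝ)) this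

/-- If `det W_i` takes infinitely often the values `1` and `m` with `|m|` not a square, then `ξ` is
not conjugate to an extremal number with an associated sequence in `GL₂(ℤ)`. -/
theorem IsAssociated.not_hasGLAssoc {ξ : ℝ} {W : ℕ → M2} {m : ℤ} (h : IsAssociated ξ W)
    (h1 : ∀ i, 1 ≤ i → 3 ∣ i → (W i).det = 1) (h2 : ∀ i, 1 ≤ i → ¬ 3 ∣ i → (W i).det = m)
    (hm : ¬ ∃ n : ℤ, n * n = |m|) (A : Matrix (Fin 2) (Fin 2) ℚ) (hA : A.det ≠ 0) :
    ¬ HasGLAssoc (((A 0 0 : ℝ) * ξ + (A 0 1 : ℝ)) / ((A 1 0 : ℝ) * ξ + (A 1 1 : ℝ))) := by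
  rintro ⟨-, V, hV, hGL⟩
  obtain ⟨P, q, hq, hP, hPA⟩ := exists_int_representative A hA
  have hq' : (q : ℝ) ≠ 0 := by exact_mod_cast hq
  have hne : (P 1 0 : ℝ) * ξ + P 1 1 ≠ 0 := by
    have := h.not_quadratic 0 (P 1 0) (P 1 1) (by
      rintro ⟨-, h0, h0'⟩
      exact hP (by rw [Matrix.det_fin_two, h0, h0']; ring))
    simpa using this
  have hden : (A 1 0 : ℝ) * ξ + A 1 1 ≠ 0 := by
    intro h0
    apply hne
    rw [hPA, hPA]
    linear_combination (q : ℝ) * h0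
  obtain ⟨i, a, b, hi, ha, hb, hsq⟩ := h.det_square_class hV hGL
    !![P 0 0, -P 1 0; -P 0 1, P 1 1] (l := P 1 0 * ξ + P 1 1)
    (by rw [Matrix.det_fin_two] at hP ⊢; simpa [mul_comm] using hP)
    (by
      simp only [Matrix.of_apply, Matrix.cons_val', Matrix.cons_val_zero, Matrix.cons_val_one,
        Matrix.cons_val_fin_one, Int.cast_neg, hPA]
      linear_combination -(q : ℝ) * div_mul_cancel₀ ((A 0 0 : ℝ) * ξ + A 0 1) hden)
    (by simp; ring)
  obtain ⟨n, hn⟩ : ∃ n : ℕ, i ≤ n := ⟨i.toNat, Int.self_le_toNat i⟩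
  obtain ⟨k, l, hk, hkl⟩ := hsq (3 * n) (by push_cast; omega)
  obtain ⟨k', l', hk', hkl'⟩ := hsq (3 * n + 1) (by push_cast; omega)
  rw [h1 _ (by omega) (by omega), abs_one, one_mul] at hkl
  rw [h2 _ (by omega) (by omega)] at hkl'
  have hl' : l' ≠ 0 := by
    rintro rfl
    have : k' ^ 2 * a ≠ 0 := mul_ne_zero (pow_ne_zero 2 hk') ha
    exact this (by rw [hkl']; ring)
  refine hm (exists_sq_eq_of_sq_mul_eq (mul_ne_zero hk hl') (b := k' * l) ?_)
  refine mul_left_cancel₀ (mul_ne_zero ha hb) ?_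
  linear_combination l' ^ 2 * |m| * b * hkl - l ^ 2 * b * hkl'

lemma red_eq_of_smul_eq {A V : M2} {k : ℤ} (hk : 0 < k) (hV : Primitive V) (h : A = k • V) :
    red A = V := by
  rw [h, red_smul_of_primitive hk hV]

/-- Determinant `1` and upper right entry divisible by `m`. -/
def UnitType (m : ℤ) (A : M2) : Prop := A.det = 1 ∧ m ∣ A 0 1

/-- Determinant `m` and all entries but the lower left one divisible by `m`. -/
def DetType (m : ℤ) (A : M2) : Prop := A.det = m ∧ m ∣ A 0 0 ∧ m ∣ A 0 1 ∧ m ∣ A 1 1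

lemma primitive_of_forall_dvd {A : M2} (h : ∀ k : ℤ, (∀ i j, k ∣ A i j) → k ∣ 1) : Primitive A := by
  have := h _ (content_dvd A)
  exact Nat.dvd_one.mp (by exact_mod_cast this)

lemma UnitType.primitive {m : ℤ} {A : M2} (h : UnitType m A) : Primitive A :=
  primitive_of_forall_dvd fun k hk => by
    rw [← h.1, Matrix.det_fin_two]
    exact dvd_sub ((hk 0 0).mul_right _) ((hk 0 1).mul_right _)

lemma DetType.primitive {m : ℤ} (hm : m ≠ 0) {A : M2} (h : DetType m A) : Primitive A :=
  primitive_of_forall_dvd fun k hk => by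
    obtain ⟨hdet, ⟨a, ha⟩, ⟨b, hb⟩, ⟨d, hd⟩⟩ := h
    have hkm : k ∣ m := by
      rw [← hdet, Matrix.det_fin_two]
      exact dvd_sub ((hk 0 0).mul_right _) ((hk 0 1).mul_right _)
    rw [Matrix.det_fin_two, ha, hb, hd] at hdet
    have : m * (a * d) - b * A 1 0 = 1 :=
      mul_left_cancel₀ hm (by linear_combination hdet)
    rw [← this]
    exact dvd_sub (hkm.mul_right _) ((hk 1 0).mul_left _)

lemma UnitType.mul {m : ℤ} {A B : M2} (hA : UnitType m A) (hB : UnitType m B) :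
    UnitType m (A * B) := by
  refine ⟨by rw [Matrix.det_mul, hA.1, hB.1, one_mul], ?_⟩
  simp only [Matrix.mul_apply, Fin.sum_univ_two]
  exact dvd_add (hB.2.mul_left _) (hA.2.mul_right _)

lemma UnitType.mul_detType {m : ℤ} {A B : M2} (hA : UnitType m A) (hB : DetType m B) :
    DetType m (A * B) := by
  obtain ⟨d, b0, b1, b2⟩ := hB
  refine ⟨by rw [Matrix.det_mul, hA.1, d, one_mul], ?_, ?_, ?_⟩ <;>
    simp only [Matrix.mul_apply, Fin.sum_univ_two]
  · exact dvd_add (b0.mul_left _) (hA.2.mul_right _)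
  · exact dvd_add (b1.mul_left _) (hA.2.mul_right _)
  · exact dvd_add (b1.mul_left _) (b2.mul_left _)

lemma DetType.mul_unitType {m : ℤ} {A B : M2} (hA : DetType m A) (hB : UnitType m B) :
    DetType m (A * B) := by
  obtain ⟨d, a0, a1, a2⟩ := hA
  refine ⟨by rw [Matrix.det_mul, hB.1, d, mul_one], ?_, ?_, ?_⟩ <;>
    simp only [Matrix.mul_apply, Fin.sum_univ_two]
  · exact dvd_add (a0.mul_right _) (a1.mul_right _)
  · exact dvd_add (a0.mul_right _) (a1.mul_right _)
  · exact dvd_add (hB.2.mul_left _) (a2.mul_right _)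

lemma DetType.mul {m : ℤ} (hm : m ≠ 0) {A B : M2} (hA : DetType m A) (hB : DetType m B) :
    ∃ V, UnitType m V ∧ A * B = |m| • V := by
  have hm2 : |m| * |m| = m * m := abs_mul_abs_self m
  have hdvd : ∀ i j, |m| ∣ (A * B) i j := by
    obtain ⟨-, a0, a1, a2⟩ := hA
    obtain ⟨-, b0, b1, b2⟩ := hB
    intro i j
    rw [abs_dvd]
    fin_cases i <;> fin_cases j <;>
      simp only [Matrix.mul_apply, Fin.sum_univ_two, Fin.zero_eta, Fin.mk_one]
    · exact dvd_add (a0.mul_right _) (a1.mul_right _)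
    · exact dvd_add (a0.mul_right _) (a1.mul_right _)
    · exact dvd_add (b0.mul_left _) (a2.mul_right _)
    · exact dvd_add (b1.mul_left _) (a2.mul_right _)
  choose V hV using hdvd
  have hAB : A * B = |m| • Matrix.of V := by
    ext i j
    rw [hV]; simp
  refine ⟨Matrix.of V, ⟨?_, ?_⟩, hAB⟩
  · have := congrArg Matrix.det hAB
    rw [Matrix.det_mul, Matrix.det_smul, hA.1, hB.1, Fintype.card_fin, sq_abs] at this
    refine mul_left_cancel₀ (pow_ne_zero 2 hm) ?_
    rw [← this]; ring
  · have h01 : m * m ∣ (A * B) 0 1 := by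
      simp only [Matrix.mul_apply, Fin.sum_univ_two]
      exact dvd_add (mul_dvd_mul hA.2.1 hB.2.2.1) (mul_dvd_mul hA.2.2.1 hB.2.2.2)
    rw [hV, ← hm2] at h01
    rw [← abs_dvd]
    exact Int.dvd_of_mul_dvd_mul_left (abs_ne_zero.mpr hm) h01

/-- The integer matrices of one of the two types occurring in the sequence. -/
def SeqType (m : ℤ) (A : M2) : Prop := UnitType m A ∨ DetType m A

lemma SeqType.primitive {m : ℤ} (hm : m ≠ 0) {A : M2} (h : SeqType m A) : Primitive A :=
  h.elim UnitType.primitive (DetType.primitive hm)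

lemma SeqType.det_ne_zero {m : ℤ} (hm : m ≠ 0) {A : M2} (h : SeqType m A) : A.det ≠ 0 := by
  rcases h with h | h <;> rw [h.1]
  · exact one_ne_zero
  · exact hm

lemma SeqType.abs_det_le {m : ℤ} (hm : m ≠ 0) {A : M2} (h : SeqType m A) : |A.det| ≤ |m| := by
  rcases h with h | h <;> rw [h.1]
  rw [abs_one]; exact Int.one_le_abs hm

lemma UnitType.pmul {m : ℤ} {A B : M2} (hA : UnitType m A) (hB : UnitType m B) :
    pmul A B = A * B :=
  red_eq_of_smul_eq one_pos (hA.mul hB).primitive (one_smul _ _).symm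

lemma UnitType.pmul_detType {m : ℤ} (hm : m ≠ 0) {A B : M2} (hA : UnitType m A)
    (hB : DetType m B) : _root_.pmul A B = A * B :=
  red_eq_of_smul_eq one_pos ((hA.mul_detType hB).primitive hm) (one_smul _ _).symm

lemma DetType.pmul_unitType {m : ℤ} (hm : m ≠ 0) {A B : M2} (hA : DetType m A)
    (hB : UnitType m B) : pmul A B = A * B :=
  red_eq_of_smul_eq one_pos ((hA.mul_unitType hB).primitive hm) (one_smul _ _).symm

lemma DetType.pmul {m : ℤ} (hm : m ≠ 0) {A B : M2} (hA : DetType m A) (hB : DetType m B) :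
    UnitType m (_root_.pmul A B) ∧ |m| • _root_.pmul A B = A * B := by
  obtain ⟨V, hV, h⟩ := hA.mul hm hB
  have : _root_.pmul A B = V := red_eq_of_smul_eq (abs_pos.mpr hm) hV.primitive h
  rw [this]
  exact ⟨hV, h.symm⟩

lemma SeqType.pmul {m : ℤ} (hm : m ≠ 0) {A B : M2} (hA : SeqType m A) (hB : SeqType m B) :
    SeqType m (pmul A B) ∧ ∃ k : ℤ, 0 < k ∧ k ≤ |m| ∧ k • _root_.pmul A B = A * B ∧
      (k = 1 ∨ (k = |m| ∧ DetType m A ∧ DetType m B)) := by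
  have h1 := Int.one_le_abs hm
  rcases hA with hA | hA <;> rcases hB with hB | hB
  · rw [hA.pmul hB]
    exact ⟨.inl (hA.mul hB), 1, one_pos, h1, one_smul _ _, .inl rfl⟩
  · rw [hA.pmul_detType hm hB]
    exact ⟨.inr (hA.mul_detType hB), 1, one_pos, h1, one_smul _ _, .inl rfl⟩
  · rw [hA.pmul_unitType hm hB]
    exact ⟨.inr (hA.mul_unitType hB), 1, one_pos, h1, one_smul _ _, .inl rfl⟩
  · obtain ⟨h, h'⟩ := hA.pmul hm hB
    exact ⟨.inl h, |m|, by omega, le_rfl, h', .inr ⟨rfl, hA, hB⟩⟩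

lemma eq_of_smul_eq_smul {A B : M2} {k l : ℤ} (hk : 0 < k) (hl : 0 < l) (hA : Primitive A)
    (hB : Primitive B) (h : k • A = l • B) : A = B := by
  rw [← red_smul_of_primitive hk hA, h, red_smul_of_primitive hl hB]

lemma SeqType.pmul_assoc {m : ℤ} (hm : m ≠ 0) {A B C : M2} (hA : SeqType m A) (hB : SeqType m B)
    (hC : SeqType m C) : _root_.pmul (_root_.pmul A B) C = _root_.pmul A (_root_.pmul B C) := by
  obtain ⟨h1, k1, hk1, -, e1, -⟩ := hA.pmul hm hB
  obtain ⟨h2, k2, hk2, -, e2, -⟩ := h1.pmul hm hC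
  obtain ⟨h3, k3, hk3, -, e3, -⟩ := hB.pmul hm hC
  obtain ⟨h4, k4, hk4, -, e4, -⟩ := hA.pmul hm h3
  refine eq_of_smul_eq_smul (mul_pos hk1 hk2) (mul_pos hk3 hk4) (h2.primitive hm)
    (h4.primitive hm) ?_
  rw [mul_smul, mul_smul, e2, e4, ← Matrix.smul_mul, ← Matrix.mul_smul, e1, e3, Matrix.mul_assoc]

/-- All entries positive, and entries in a common row or column comparable. -/
def EntryBalanced (A : M2) : Prop :=
  (∀ i j, 0 < A i j) ∧ (∀ i j j', A i j ≤ 3 * A i j') ∧ ∀ i i' j, A i j ≤ 3 * A i' j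

lemma EntryBalanced.mul {A B : M2} (hA : EntryBalanced A) (hB : EntryBalanced B) :
    EntryBalanced (A * B) := by
  obtain ⟨a0, a1, a2⟩ := hA
  obtain ⟨b0, b1, b2⟩ := hB
  refine ⟨fun i j => ?_, fun i j j' => ?_, fun i i' j => ?_⟩ <;>
    simp only [Matrix.mul_apply, Fin.sum_univ_two]
  · exact add_pos (mul_pos (a0 _ _) (b0 _ _)) (mul_pos (a0 _ _) (b0 _ _))
  · have h0 := mul_le_mul_of_nonneg_left (b1 0 j j') (a0 i 0).le
    have h1 := mul_le_mul_of_nonneg_left (b1 1 j j') (a0 i 1).le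
    linarith
  · have h0 := mul_le_mul_of_nonneg_right (a2 i i' 0) (b0 0 j).le
    have h1 := mul_le_mul_of_nonneg_right (a2 i i' 1) (b0 1 j).le
    linarith

lemma EntryBalanced.of_smul {A : M2} {k : ℤ} (hk : 0 < k) (h : EntryBalanced (k • A)) :
    EntryBalanced A := by
  obtain ⟨a0, a1, a2⟩ := h
  simp only [Matrix.smul_apply, smul_eq_mul, mul_left_comm (3 : ℤ)] at a0 a1 a2
  exact ⟨fun i j => pos_of_mul_pos_right (a0 i j) hk.le,
    fun i j j' => le_of_mul_le_mul_left (a1 i j j') hk,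
    fun i i' j => le_of_mul_le_mul_left (a2 i i' j) hk⟩

lemma EntryBalanced.smul {A : M2} {k : ℤ} (hk : 0 < k) (h : EntryBalanced A) :
    EntryBalanced (k • A) := by
  obtain ⟨a0, a1, a2⟩ := h
  refine ⟨fun i j => mul_pos hk (a0 i j), fun i j j' => ?_, fun i i' j => ?_⟩ <;>
    simp only [Matrix.smul_apply, smul_eq_mul, mul_left_comm (3 : ℤ)]
  · exact mul_le_mul_of_nonneg_left (a1 i j j') hk.le
  · exact mul_le_mul_of_nonneg_left (a2 i i' j) hk.le

/-- Balanced up to sign. -/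
def SignBalanced (A : M2) : Prop := EntryBalanced A ∨ EntryBalanced (-A)

lemma SignBalanced.mul {A B : M2} (hA : SignBalanced A) (hB : SignBalanced B) :
    SignBalanced (A * B) := by
  rcases hA with hA | hA <;> rcases hB with hB | hB
  · exact .inl (hA.mul hB)
  · exact .inr (by simpa using hA.mul hB)
  · exact .inr (by simpa using hA.mul hB)
  · exact .inl (by simpa using hA.mul hB)

lemma SignBalanced.of_smul {A : M2} {k : ℤ} (hk : 0 < k) (h : SignBalanced (k • A)) :
    SignBalanced A :=
  h.imp (.of_smul hk) fun h => .of_smul hk (by rwa [smul_neg])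

lemma SignBalanced.abs {A : M2} (h : SignBalanced A) :
    (∀ i j, 0 < |A i j|) ∧ (∀ i j j', |A i j| ≤ 3 * |A i j'|) ∧
      ∀ i i' j, |A i j| ≤ 3 * |A i' j| := by
  rcases h with h | h
  · simp only [abs_of_pos (h.1 _ _)]
    exact h
  · have : ∀ i j, |A i j| = (-A) i j := fun i j => by
      rw [← abs_of_pos (h.1 i j), Matrix.neg_apply, abs_neg]
    simp only [this]
    exact h

lemma SignBalanced.mul_pos {A : M2} (h : SignBalanced A) (i j k l : Fin 2) : 0 < A i j * A k l := by
  rcases h with h | h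
  · exact _root_.mul_pos (h.1 i j) (h.1 k l)
  · have := _root_.mul_pos (h.1 i j) (h.1 k l)
    simpa using this

lemma SignBalanced.abs_mul_apply {A B : M2} (hA : SignBalanced A) (hB : SignBalanced B) :
    |(A * B) 0 0| = |A 0 0| * |B 0 0| + |A 0 1| * |B 1 0| := by
  simp only [Matrix.mul_apply, Fin.sum_univ_two]
  rw [← abs_mul, ← abs_mul, abs_add_eq_add_abs_iff]
  have h := _root_.mul_pos (hA.mul_pos 0 0 0 1) (hB.mul_pos 0 0 1 0)
  rw [mul_mul_mul_comm, mul_pos_iff] at h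
  exact h.imp (fun h => ⟨h.1.le, h.2.le⟩) fun h => ⟨h.1.le, h.2.le⟩

lemma SignBalanced.mnorm_le {A : M2} (h : SignBalanced A) : mnorm A ≤ 9 * |(A 0 0 : ℝ)| := by
  obtain ⟨-, h1, h2⟩ := h.abs
  refine _root_.mnorm_le fun i j => ?_
  have := (h1 i j 0).trans (mul_le_mul_of_nonneg_left (h2 i 0 0) (by norm_num : (0 : ℤ) ≤ 3))
  rw [← Int.cast_abs, ← Int.cast_abs]
  exact_mod_cast this.trans (by linarith)

/-- The Fibonacci sequence of matrices generated by `W₁ = (m m; m-1 m)`, `W₂ = (2m m; 2m-1 m)`. -/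
structure IsDetFib (m : ℤ) (W : ℕ → M2) : Prop where
  ne : m ≠ 0
  one : W 1 = !![m, m; m - 1, m]
  two : W 2 = !![2 * m, m; 2 * m - 1, m]
  fib : ∀ i, 1 ≤ i → W (i + 2) = pmul (W (i + 1)) (W i)

namespace IsDetFib

variable {m : ℤ} {W : ℕ → M2}

lemma types_aux (h : IsDetFib m W) (k : ℕ) :
    DetType m (W (3 * k + 1)) ∧ DetType m (W (3 * k + 2)) ∧ UnitType m (W (3 * k + 3)) := by
  have three : ∀ j, 1 ≤ j → DetType m (W j) → DetType m (W (j + 1)) → UnitType m (W (j + 2)) :=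
    fun j hj h1 h2 => by
      rw [h.fib j hj]
      exact (h2.pmul h.ne h1).1
  induction k with
  | zero =>
    have h1 : DetType m (W 1) := by
      rw [h.one]
      refine ⟨?_, ?_, ?_, ?_⟩ <;> simp [Matrix.det_fin_two]
      ring
    have h2 : DetType m (W 2) := by
      rw [h.two]
      refine ⟨?_, ?_, ?_, ?_⟩ <;> simp [Matrix.det_fin_two]
      ring
    exact ⟨h1, h2, three 1 le_rfl h1 h2⟩
  | succ k ih =>
    obtain ⟨-, h2, h3⟩ := ih
    have h4 : DetType m (W (3 * k + 4)) := by
      rw [h.fib (3 * k + 2) (by omega), h3.pmul_detType h.ne h2]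
      exact h3.mul_detType h2
    have h5 : DetType m (W (3 * k + 5)) := by
      rw [h.fib (3 * k + 3) (by omega), h4.pmul_unitType h.ne h3]
      exact h4.mul_unitType h3
    exact ⟨h4, h5, three _ (by omega) h4 h5⟩

lemma unitType (h : IsDetFib m W) {i : ℕ} (hi : 1 ≤ i) (h3 : 3 ∣ i) : UnitType m (W i) := by
  obtain ⟨k, rfl⟩ : ∃ k, i = 3 * k + 3 := ⟨i / 3 - 1, by omega⟩
  exact (h.types_aux k).2.2

lemma detType (h : IsDetFib m W) {i : ℕ} (hi : 1 ≤ i) (h3 : ¬ 3 ∣ i) : DetType m (W i) := by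
  have : (∃ k, i = 3 * k + 1) ∨ ∃ k, i = 3 * k + 2 := by
    rcases (by omega : i % 3 = 1 ∨ i % 3 = 2) with h | h
    · exact .inl ⟨i / 3, by omega⟩
    · exact .inr ⟨i / 3, by omega⟩
  rcases this with ⟨k, rfl⟩ | ⟨k, rfl⟩
  · exact (h.types_aux k).1
  · exact (h.types_aux k).2.1

lemma seqType (h : IsDetFib m W) {i : ℕ} (hi : 1 ≤ i) : SeqType m (W i) := by
  by_cases h3 : 3 ∣ i
  · exact .inl (h.unitType hi h3)
  · exact .inr (h.detType hi h3)

lemma smul_eq (h : IsDetFib m W) {i : ℕ} (hi : 1 ≤ i) :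
    ∃ k : ℤ, 0 < k ∧ k ≤ |m| ∧ k • W (i + 2) = W (i + 1) * W i := by
  obtain ⟨-, k, h1, h2, h3, -⟩ := (h.seqType (i := i + 1) (by omega)).pmul h.ne (h.seqType hi)
  exact ⟨k, h1, h2, by rw [h.fib i hi, h3]⟩

lemma isFibP (h : IsDetFib m W) : IsFibP W :=
  ⟨fun _ hi => ⟨(h.seqType hi).primitive h.ne, (h.seqType hi).det_ne_zero h.ne⟩, h.fib⟩

lemma three (h : IsDetFib m W) : |m| • W 3 = m • !![3 * m - 1, 3 * m; 3 * m - 2, 3 * m - 1] := by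
  have h1 : DetType m (W 1) := h.detType le_rfl (by norm_num)
  have h2 : DetType m (W 2) := h.detType (by norm_num) (by norm_num)
  rw [h.fib 1 le_rfl, (h2.pmul h.ne h1).2, h.one, h.two]
  ext i j
  fin_cases i <;> fin_cases j <;> simp [Matrix.mul_apply, Fin.sum_univ_two] <;> ring

lemma signBalanced_two (h : IsDetFib m W) : SignBalanced (W 2) := by
  have hm := h.ne
  rw [h.two]
  rcases lt_or_gt_of_ne hm with hneg | hpos
  · right
    refine ⟨fun i j => ?_, fun i j j' => ?_, fun i i' j => ?_⟩
    · fin_cases i <;> fin_cases j <;> simp <;> omega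
    · fin_cases i <;> fin_cases j <;> fin_cases j' <;> simp <;> omega
    · fin_cases i <;> fin_cases i' <;> fin_cases j <;> simp <;> omega
  · left
    refine ⟨fun i j => ?_, fun i j j' => ?_, fun i i' j => ?_⟩
    · fin_cases i <;> fin_cases j <;> simp <;> omega
    · fin_cases i <;> fin_cases j <;> fin_cases j' <;> simp <;> omega
    · fin_cases i <;> fin_cases i' <;> fin_cases j <;> simp <;> omega

lemma signBalanced_three (h : IsDetFib m W) : SignBalanced (W 3) := by
  have hm := h.ne
  refine .of_smul (abs_pos.mpr hm) ?_
  rw [h.three]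
  left
  rcases lt_or_gt_of_ne hm with hneg | hpos
  · rw [← neg_smul_neg]
    refine .smul (by omega) ⟨fun i j => ?_, fun i j j' => ?_, fun i i' j => ?_⟩
    · fin_cases i <;> fin_cases j <;> simp <;> omega
    · fin_cases i <;> fin_cases j <;> fin_cases j' <;> simp <;> omega
    · fin_cases i <;> fin_cases i' <;> fin_cases j <;> simp <;> omega
  · refine .smul hpos ⟨fun i j => ?_, fun i j j' => ?_, fun i i' j => ?_⟩
    · fin_cases i <;> fin_cases j <;> simp <;> omega
    · fin_cases i <;> fin_cases j <;> fin_cases j' <;> simp <;> omega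
    · fin_cases i <;> fin_cases i' <;> fin_cases j <;> simp <;> omega

lemma signBalanced (h : IsDetFib m W) {i : ℕ} (hi : 2 ≤ i) : SignBalanced (W i) := by
  obtain ⟨i, rfl⟩ := Nat.exists_eq_add_of_le hi
  suffices SignBalanced (W (i + 2)) ∧ SignBalanced (W (i + 3)) by
    rw [add_comm]; exact this.1
  clear hi
  induction i with
  | zero => exact ⟨h.signBalanced_two, h.signBalanced_three⟩
  | succ i ih =>
    refine ⟨ih.2, ?_⟩
    obtain ⟨k, hk, -, e⟩ := h.smul_eq (i := i + 2) (by omega)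
    exact .of_smul hk (e ▸ ih.2.mul ih.1)

lemma admissible (h : IsDetFib m W) : AdmissibleFib W := by
  have hm := h.ne
  set N : M2 := !![m, -m; -2 * m, 2 * m - 1] with hN
  have hdet : N.det = -m := by rw [hN, Matrix.det_fin_two]; simp; ring
  refine ⟨N, ⟨primitive_of_forall_dvd fun k hk => ?_, by rw [hdet]; omega⟩, fun e => ?_,
    fun e => ?_, fun i hi => ?_⟩
  · have h0 : k ∣ m := hk 0 0
    have h1 : k ∣ 2 * m - 1 := hk 1 1
    have := dvd_sub (h0.mul_left 2) h1
    simpa using this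
  · have := congrFun (congrFun e 0) 1
    simp [hN] at this
    omega
  · have := congrFun (congrFun e 0) 0
    simp [hN] at this
    omega
  set M : ℕ → M2 := fun i => if i % 2 = 1 then Nᵀ else N with hM
  have hMT : ∀ i, (M (i + 1))ᵀ = M i := fun i => by
    rcases Nat.mod_two_eq_zero_or_one i with h | h <;> simp [hM, Nat.add_mod, h]
  have hM2 : ∀ i, M (i + 2) = M i := fun i => by simp [hM]
  obtain ⟨i, rfl⟩ : ∃ j, i = j + 1 := ⟨i - 1, by omega⟩
  suffices (W (i + 1) * M (i + 1)).IsSymm ∧ (W (i + 2) * M (i + 2)).IsSymm ∧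
      (W (i + 3) * M (i + 3)).IsSymm from this.1
  have of_smul : ∀ {k : ℤ} {A : M2}, k ≠ 0 → (k • A).IsSymm → A.IsSymm := by
    intro k A hk hA
    ext i j
    have := hA.apply i j
    exact mul_left_cancel₀ hk this
  clear hi
  induction i with
  | zero =>
    have h1 : W 1 * M 1 = !![0, -m; -m, m] := by
      rw [h.one]
      ext i j
      fin_cases i <;> fin_cases j <;> simp [hM, hN, Matrix.mul_apply, Fin.sum_univ_two] <;> ring
    refine ⟨?_, ?_, ?_⟩
    · rw [h1]
      ext i j
      fin_cases i <;> fin_cases j <;> simp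
    · have : W 2 * M 2 = !![0, -m; -m, 0] := by
        rw [h.two]
        ext i j
        fin_cases i <;> fin_cases j <;> simp [hM, hN, Matrix.mul_apply, Fin.sum_univ_two] <;> ring
      rw [this]
      ext i j
      fin_cases i <;> fin_cases j <;> simp
    · obtain ⟨k, hk, -, e⟩ := h.smul_eq le_rfl
      refine of_smul hk.ne' ?_
      have : M 3 = M 1 := hM2 1
      rw [← Matrix.smul_mul, e, this, Matrix.mul_assoc, h1, h.two]
      ext i j
      fin_cases i <;> fin_cases j <;> simp [Matrix.mul_apply, Fin.sum_univ_two] <;> ring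
  | succ i ih =>
    obtain ⟨s1, s2, s3⟩ := ih
    refine ⟨s2, s3, ?_⟩
    obtain ⟨k, hk, -, e⟩ := h.smul_eq (i := i + 1) (by omega)
    obtain ⟨l, hl, -, e'⟩ := h.smul_eq (i := i + 2) (by omega)
    refine of_smul (mul_pos hk hl).ne' ?_
    have e2 : (k * l) • (W (i + 4) * M (i + 4)) =
        W (i + 2) * (W (i + 1) * M (i + 1)) * (W (i + 2))ᵀ := by
      have t := s2
      rw [Matrix.IsSymm, Matrix.transpose_mul, hMT] at t
      rw [mul_smul, ← Matrix.smul_mul, e', hM2, Matrix.mul_assoc, ← Matrix.smul_mul, e, ← t]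
      simp only [Matrix.mul_assoc]
    show ((k * l) • (W (i + 4) * M (i + 4))).IsSymm
    rw [e2, Matrix.IsSymm, Matrix.transpose_mul, Matrix.transpose_mul (W (i + 2)),
      Matrix.transpose_transpose, s1]
    simp only [Matrix.mul_assoc]

end IsDetFib

/-- `ξ` lies between the quotients `c / a` and `d / b` for `A = (a b; c d)`. -/
def Between (ξ : ℝ) (A : M2) : Prop := (ξ * A 0 0 - A 1 0) * (ξ * A 0 1 - A 1 1) ≤ 0

/-- `(u, v) ↦ (u, v) R` preserves the set of row vectors with coordinates of the same sign. -/
def SignPreserving (R : M2) : Prop :=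
  ∀ u v : ℝ, 0 < u * v → 0 < (u * R 0 0 + v * R 1 0) * (u * R 0 1 + v * R 1 1)

lemma SignPreserving.one : SignPreserving 1 := fun u v h => by simpa using h

lemma SignPreserving.mul {R S : M2} (hR : SignPreserving R) (hS : SignPreserving S) :
    SignPreserving (R * S) := fun u v h => by
  have := hS _ _ (hR u v h)
  simp only [Matrix.mul_apply, Fin.sum_univ_two, Int.cast_add, Int.cast_mul]
  linarith

lemma SignBalanced.signPreserving {R : M2} (hR : SignBalanced R) : SignPreserving R :=
  fun u v h => by
    have hpos : ∀ i j k l : Fin 2, (0 : ℝ) < R i j * R k l := fun i j k l => by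
      exact_mod_cast hR.mul_pos i j k l
    have e : (u * R 0 0 + v * R 1 0) * (u * R 0 1 + v * R 1 1) =
        u ^ 2 * (R 0 0 * R 0 1) + v ^ 2 * (R 1 0 * R 1 1) +
          u * v * (R 0 0 * R 1 1 + R 1 0 * R 0 1) := by ring
    rw [e]
    have h1 := mul_nonneg (sq_nonneg u) (hpos 0 0 0 1).le
    have h2 := mul_nonneg (sq_nonneg v) (hpos 1 0 1 1).le
    have h3 := _root_.mul_pos h (add_pos (hpos 0 0 1 1) (hpos 1 0 0 1))
    linarith

lemma Between.of_mul {ξ : ℝ} {M R V : M2} {k : ℤ} (h : Between ξ V) (hR : SignPreserving R)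
    (e : M * R = k • V) : Between ξ M := by
  by_contra hM
  rw [Between, not_le] at hM
  have h1 := hR _ _ hM
  have e' : ∀ j, (M 0 0 : ℝ) * R 0 j + M 0 1 * R 1 j = k * V 0 j ∧
      (M 1 0 : ℝ) * R 0 j + M 1 1 * R 1 j = k * V 1 j := fun j => by
    have h0 := congrFun (congrFun e 0) j
    have h1 := congrFun (congrFun e 1) j
    simp only [Matrix.mul_apply, Fin.sum_univ_two, Matrix.smul_apply, smul_eq_mul] at h0 h1
    exact ⟨by exact_mod_cast h0, by exact_mod_cast h1⟩
  have col : ∀ j, (ξ * M 0 0 - M 1 0) * R 0 j + (ξ * M 0 1 - M 1 1) * R 1 j =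
      k * (ξ * V 0 j - V 1 j) := fun j => by
    linear_combination ξ * (e' j).1 - (e' j).2
  rw [col, col] at h1
  have h2 := mul_nonpos_of_nonneg_of_nonpos (sq_nonneg (k : ℝ)) h
  linarith

lemma SignBalanced.mem_Icc_of_between {ξ : ℝ} {A : M2} (hA : SignBalanced A) (h : Between ξ A) :
    ξ ∈ Set.Icc (0 : ℝ) 3 := by
  have aux : ∀ {A : M2}, EntryBalanced A → Between ξ A → ξ ∈ Set.Icc (0 : ℝ) 3 := by
    intro A hA h
    have p : ∀ i j, (0 : ℝ) < A i j := fun i j => by exact_mod_cast hA.1 i j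
    have q : ∀ j, (A 1 j : ℝ) ≤ 3 * A 0 j := fun j => by exact_mod_cast hA.2.2 1 0 j
    rw [Between] at h
    constructor <;> by_contra hξ <;> rw [not_le] at hξ
    · have h0 : ξ * A 0 0 - A 1 0 < 0 := by nlinarith [p 0 0, p 1 0]
      have h1 : ξ * A 0 1 - A 1 1 < 0 := by nlinarith [p 0 1, p 1 1]
      nlinarith
    · have h0 : 0 < ξ * A 0 0 - A 1 0 := by nlinarith [p 0 0, q 0]
      have h1 : 0 < ξ * A 0 1 - A 1 1 := by nlinarith [p 0 1, q 1]
      nlinarith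
  rcases hA with hA | hA
  · exact aux hA h
  · refine aux hA ?_
    simp only [Between, Matrix.neg_apply, Int.cast_neg] at h ⊢
    linarith

lemma SignBalanced.abs_mul_abs_le {ξ : ℝ} {A : M2} (hA : SignBalanced A) (h : Between ξ A) :
    |(A 0 1 : ℝ)| * |ξ * A 0 0 - A 1 0| ≤ |(A.det : ℝ)| ∧
      |(A 0 0 : ℝ)| * |ξ * A 0 1 - A 1 1| ≤ |(A.det : ℝ)| := by
  have hpos : (0 : ℝ) < A 0 0 * A 0 1 := by exact_mod_cast hA.mul_pos 0 0 0 1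
  have e : (A.det : ℝ) = A 0 1 * (ξ * A 0 0 - A 1 0) - A 0 0 * (ξ * A 0 1 - A 1 1) := by
    rw [Matrix.det_fin_two]; push_cast; ring
  have hprod := mul_nonpos_of_nonneg_of_nonpos hpos.le h
  rw [e, ← abs_mul, ← abs_mul]
  constructor <;> refine sq_le_sq.mp ?_ <;> nlinarith

lemma SignBalanced.xiNorm_mul_mnorm_le {ξ : ℝ} {A : M2} (hA : SignBalanced A) (h : Between ξ A) :
    xiNorm ξ A * mnorm A ≤ 27 * |(A.det : ℝ)| := by
  obtain ⟨h1, h2⟩ := hA.abs_mul_abs_le h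
  have h01 : |(A 0 0 : ℝ)| ≤ 3 * |(A 0 1 : ℝ)| := by exact_mod_cast hA.abs.2.1 0 0 1
  have h3 : xiNorm ξ A * |(A 0 0 : ℝ)| ≤ 3 * |(A.det : ℝ)| := by
    rw [xiNorm, max_mul_of_nonneg _ _ (abs_nonneg _)]
    refine max_le ?_ ?_
    · calc _ ≤ |ξ * A 0 0 - A 1 0| * (3 * |(A 0 1 : ℝ)|) := by gcongr
        _ ≤ _ := by linarith
    · have := abs_nonneg (A.det : ℝ)
      linarith
  calc xiNorm ξ A * mnorm A ≤ xiNorm ξ A * (9 * |(A 0 0 : ℝ)|) := by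
        have := xiNorm_nonneg ξ A
        gcongr
        exact hA.mnorm_le
    _ ≤ _ := by linarith

/-- A sequence with `Z (i + 2) ≍ Z (i + 1) Z i` satisfies `Z (i + 1) ≍ Z i ^ γ`. -/
lemma exists_gamGrowth {Z : ℕ → ℝ} {C : ℝ} (hZ : ∀ i, 1 ≤ i → 1 ≤ Z i)
    (h1 : ∀ i, 1 ≤ i → Z (i + 2) ≤ C * (Z (i + 1) * Z i))
    (h2 : ∀ i, 2 ≤ i → Z (i + 1) * Z i ≤ C * Z (i + 2)) : ∃ E, GamGrowth Z E := by
  set C' := max (max C 1) (Z 2 * Z 1) with hC'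
  have hC1 : 1 ≤ C' := (le_max_right C 1).trans (le_max_left _ _)
  have hCC : C ≤ C' := (le_max_left C 1).trans (le_max_left _ _)
  have h1' : ∀ i, 1 ≤ i → Z (i + 2) ≤ C' * (Z (i + 1) * Z i) := fun i hi => by
    have p0 := hZ i hi
    have p1 := hZ (i + 1) (by omega)
    exact (h1 i hi).trans (by gcongr)
  have h2' : ∀ i, 1 ≤ i → Z (i + 1) * Z i ≤ C' * Z (i + 2) := fun i hi => by
    have p2 := hZ (i + 2) (by omega)
    rcases hi.eq_or_lt with rfl | hi
    · calc Z 2 * Z 1 ≤ C' := le_max_right _ _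
        _ ≤ C' * Z 3 := le_mul_of_one_le_right (by linarith) p2
    · exact (h2 i hi).trans (by gcongr)
  set L := Real.log C' with hL
  have hL0 : 0 ≤ L := Real.log_nonneg hC1
  set r : ℕ → ℝ := fun i => Real.log (Z (i + 1)) - gam * Real.log (Z i) with hr
  have hrec : ∀ i, 1 ≤ i → |r (i + 1) + (gam - 1) * r i| ≤ L := fun i hi => by
    have p0 := hZ i hi
    have p1 := hZ (i + 1) (by omega)
    have p2 := hZ (i + 2) (by omega)
    have a1 := Real.log_le_log (by linarith) (h1' i hi)
    have a2 := Real.log_le_log (by positivity) (h2' i hi)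
    rw [Real.log_mul (by positivity) (by positivity), Real.log_mul (by positivity) (by positivity)]
      at a1
    rw [Real.log_mul (by positivity) (by positivity), Real.log_mul (by positivity) (by positivity)]
      at a2
    have e : r (i + 1) + (gam - 1) * r i =
        Real.log (Z (i + 2)) - Real.log (Z (i + 1)) - Real.log (Z i) := by
      simp only [hr]
      linear_combination -Real.log (Z i) * gam_mul_sub_one
    rw [e, abs_le]
    constructor <;> linarith
  have hg := one_lt_gam
  have hg2 := gam_lt_two
  set B := max |r 1| (L / (2 - gam)) with hB
  have hBL : L ≤ (2 - gam) * B := by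
    rw [mul_comm, ← div_le_iff₀ (by linarith)]
    exact le_max_right _ _
  have hrB : ∀ i, 1 ≤ i → |r i| ≤ B := by
    intro i hi
    induction i, hi using Nat.le_induction with
    | base => exact le_max_left _ _
    | succ i hi ih =>
      have e : r (i + 1) = (r (i + 1) + (gam - 1) * r i) - (gam - 1) * r i := by ring
      rw [e]
      refine (abs_sub _ _).trans ?_
      rw [abs_mul, abs_of_pos (show 0 < gam - 1 by linarith)]
      have := mul_le_mul_of_nonneg_left ih (show 0 ≤ gam - 1 by linarith)
      linarith [hrec i hi]
  have hB0 : 0 ≤ B := (abs_nonneg _).trans (hrB 1 le_rfl)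
  refine ⟨Real.exp B, Real.one_le_exp hB0, fun i hi => ?_⟩
  have p0 := hZ i hi
  have p1 := hZ (i + 1) (by omega)
  obtain ⟨b1, b2⟩ := abs_le.mp (hrB i hi)
  simp only [hr] at b1 b2
  have e0 : Z i ^ gam = Real.exp (gam * Real.log (Z i)) := by
    rw [Real.rpow_def_of_pos (by linarith), mul_comm]
  have e1 : Z (i + 1) = Real.exp (Real.log (Z (i + 1))) := (Real.exp_log (by linarith)).symm
  refine ⟨p0, ?_, ?_⟩
  · rw [e0]
    calc Real.exp (gam * Real.log (Z i)) ≤ Real.exp (B + Real.log (Z (i + 1))) :=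
          Real.exp_le_exp.mpr (by linarith)
      _ = Real.exp B * Z (i + 1) := by rw [Real.exp_add, ← e1]
  · rw [e0, ← Real.exp_add]
    calc Z (i + 1) = Real.exp (Real.log (Z (i + 1))) := e1
      _ ≤ _ := Real.exp_le_exp.mpr (by linarith)

/-- `A` satisfies `SeqType m` and its entries are of the same sign and balanced. -/
def IsGood (m : ℤ) (A : M2) : Prop := SeqType m A ∧ SignBalanced A

namespace IsGood

variable {m : ℤ} {A B C : M2}

lemma pmul (hm : m ≠ 0) (hA : IsGood m A) (hB : IsGood m B) :
    IsGood m (pmul A B) ∧ ∃ k : ℤ, 0 < k ∧ k ≤ |m| ∧ k • _root_.pmul A B = A * B := by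
  obtain ⟨h, k, hk, hkm, e, -⟩ := hA.1.pmul hm hB.1
  exact ⟨⟨h, .of_smul hk (e ▸ hA.2.mul hB.2)⟩, k, hk, hkm, e⟩

lemma smul_abs_eq {k : ℤ} (hk : 0 < k) (hA : IsGood m A) (hB : IsGood m B)
    (e : k • C = A * B) :
    k * |C 0 0| = |A 0 0| * |B 0 0| + |A 0 1| * |B 1 0| := by
  rw [← hA.2.abs_mul_apply hB.2, ← e, Matrix.smul_apply, smul_eq_mul, abs_mul, abs_of_pos hk]

/-- Products in `𝒫` of good matrices have growing upper left entry. -/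
lemma abs_add_one_le (hm : m ≠ 0) (hA : IsGood m A) (hB : IsGood m B) :
    |A 0 0| + 1 ≤ |_root_.pmul A B 0 0| := by
  obtain ⟨-, k, hk, -, e, hk'⟩ := hA.1.pmul hm hB.1
  have hkA := smul_abs_eq hk hA hB e
  have a0 := hA.2.abs.1 0 0
  have b1 := hB.2.abs.1 1 0
  have h : k ≤ |A 0 1| ∧ k ≤ |B 0 0| := by
    rcases hk' with rfl | ⟨rfl, tA, tB⟩
    · exact ⟨hA.2.abs.1 0 1, hB.2.abs.1 0 0⟩
    · exact ⟨Int.le_of_dvd (hA.2.abs.1 0 1) ((abs_dvd_abs _ _).mpr tA.2.2.1),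
        Int.le_of_dvd (hB.2.abs.1 0 0) ((abs_dvd_abs _ _).mpr tB.2.1)⟩
  refine le_of_mul_le_mul_left ?_ hk
  rw [hkA]
  nlinarith

/-- The upper left entry is multiplicative up to a factor. -/
lemma abs_pmul_le (hm : m ≠ 0) (hA : IsGood m A) (hB : IsGood m B) :
    |_root_.pmul A B 0 0| ≤ 10 * (|A 0 0| * |B 0 0|) := by
  obtain ⟨-, k, hk, -, e⟩ := hA.pmul hm hB
  have hkA := smul_abs_eq hk hA hB e
  have h := mul_le_mul (hA.2.abs.2.1 0 1 0) (hB.2.abs.2.2 1 0 0) (abs_nonneg _) (by positivity)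
  have := abs_nonneg (_root_.pmul A B 0 0)
  nlinarith

end IsGood

namespace IsDetFib

variable {m : ℤ} {W : ℕ → M2}

lemma isGood (h : IsDetFib m W) {i : ℕ} (hi : 2 ≤ i) : IsGood m (W i) :=
  ⟨h.seqType (by omega), h.signBalanced hi⟩

lemma abs_add_one_le (h : IsDetFib m W) {i : ℕ} (hi : 3 ≤ i) :
    |W i 0 0| + 1 ≤ |W (i + 1) 0 0| := by
  obtain ⟨j, rfl⟩ : ∃ j, i = j + 1 := ⟨i - 1, by omega⟩
  rw [h.fib j (by omega)]
  exact (h.isGood (by omega)).abs_add_one_le h.ne (h.isGood (by omega))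

lemma le_abs (h : IsDetFib m W) (i : ℕ) : (i : ℤ) ≤ |W (i + 3) 0 0| := by
  induction i with
  | zero => simp
  | succ i ih =>
    have := h.abs_add_one_le (i := i + 3) (by omega)
    rw [show i + 1 + 3 = i + 3 + 1 by omega]
    push_cast
    omega

lemma unboundedSeq (h : IsDetFib m W) : UnboundedSeq W := fun C => by
  obtain ⟨n, hn⟩ := exists_nat_gt C
  refine ⟨n + 3, by omega, hn.trans_le ((?_ : (n : ℝ) ≤ |(W (n + 3) 0 0 : ℝ)|).trans
    (abs_entry_le_mnorm _ 0 0))⟩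
  exact_mod_cast h.le_abs n

lemma one_le_abs_det (h : IsDetFib m W) {i : ℕ} (hi : 1 ≤ i) : 1 ≤ |((W i).det : ℝ)| := by
  exact_mod_cast Int.one_le_abs ((h.seqType hi).det_ne_zero h.ne)

lemma abs_det_le (h : IsDetFib m W) {i : ℕ} (hi : 1 ≤ i) : |((W i).det : ℝ)| ≤ |(m : ℝ)| := by
  exact_mod_cast (h.seqType hi).abs_det_le h.ne

lemma one_le_mnorm (h : IsDetFib m W) {i : ℕ} (hi : 1 ≤ i) : 1 ≤ mnorm (W i) :=
  _root_.one_le_mnorm ((h.seqType hi).det_ne_zero h.ne)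

lemma exists_gamGrowth (h : IsDetFib m W) : ∃ E, GamGrowth (fun i => mnorm (W i)) E := by
  have hm : (1 : ℝ) ≤ |(m : ℝ)| := by exact_mod_cast Int.one_le_abs h.ne
  have key : ∀ i, 1 ≤ i → ∃ k : ℝ, 1 ≤ k ∧ k ≤ |(m : ℝ)| ∧
      k * mnorm (W (i + 2)) = mnorm (W (i + 1) * W i) ∧
      k * |(W (i + 2) 0 0 : ℝ)| = |((W (i + 1) * W i) 0 0 : ℝ)| := fun i hi => by
    obtain ⟨k, hk, hkm, e⟩ := h.smul_eq hi
    have hk0 : (0 : ℝ) < k := by exact_mod_cast hk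
    refine ⟨k, by exact_mod_cast hk, by exact_mod_cast hkm, ?_, ?_⟩
    · rw [← e, mnorm_smul, abs_of_pos hk0]
    · rw [← e, Matrix.smul_apply, smul_eq_mul, Int.cast_mul, abs_mul, abs_of_pos hk0]
  refine _root_.exists_gamGrowth (C := 81 * |(m : ℝ)|) (fun i hi => h.one_le_mnorm hi)
    (fun i hi => ?_) (fun i hi => ?_)
  · obtain ⟨k, hk, -, e, -⟩ := key i hi
    have n0 := mnorm_nonneg (W (i + 2))
    have n1 : 0 ≤ mnorm (W (i + 1)) * mnorm (W i) := mul_nonneg (mnorm_nonneg _) (mnorm_nonneg _)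
    calc mnorm (W (i + 2)) ≤ k * mnorm (W (i + 2)) := le_mul_of_one_le_left n0 hk
      _ ≤ 2 * (mnorm (W (i + 1)) * mnorm (W i)) := by
        rw [e, ← mul_assoc]; exact mnorm_mul_le _ _
      _ ≤ _ := by gcongr; linarith
  · obtain ⟨k, hk, hkm, -, e⟩ := key i (by omega)
    have b1 := h.signBalanced (i := i + 1) (by omega)
    have b0 := h.signBalanced hi
    have e' : |((W (i + 1) * W i) 0 0 : ℝ)| = |(W (i + 1) 0 0 : ℝ)| * |(W i 0 0 : ℝ)| +
        |(W (i + 1) 0 1 : ℝ)| * |(W i 1 0 : ℝ)| := by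
      exact_mod_cast b1.abs_mul_apply b0
    have n0 := mnorm_nonneg (W i)
    have n1 : 0 ≤ |(W (i + 1) 0 1 : ℝ)| * |(W i 1 0 : ℝ)| := by positivity
    calc mnorm (W (i + 1)) * mnorm (W i)
        ≤ (9 * |(W (i + 1) 0 0 : ℝ)|) * (9 * |(W i 0 0 : ℝ)|) :=
          mul_le_mul b1.mnorm_le b0.mnorm_le n0 (by positivity)
      _ ≤ 81 * (k * |(W (i + 2) 0 0 : ℝ)|) := by linarith
      _ ≤ 81 * (|(m : ℝ)| * mnorm (W (i + 2))) := by
        gcongr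
        exact abs_entry_le_mnorm _ 0 0
      _ = _ := by ring

lemma exists_between (h : IsDetFib m W) : ∃ ξ, ∀ i, 3 ≤ i → Between ξ (W i) := by
  have closed : ∀ A : M2, IsClosed {ξ | Between ξ A} := fun A =>
    isClosed_le (by fun_prop) continuous_const
  have key := IsCompact.nonempty_iInter_of_sequence_nonempty_isCompact_isClosed
    (fun n => {ξ | Between ξ (W (n + 3))}) (fun n ξ hξ => ?_) (fun n => ?_) ?_
    (fun n => closed _)
  · obtain ⟨ξ, hξ⟩ := key
    rw [Set.mem_iInter] at hξ
    refine ⟨ξ, fun i hi => ?_⟩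
    obtain ⟨j, rfl⟩ := Nat.exists_eq_add_of_le' hi
    exact hξ j
  · obtain ⟨k, hk, -, e⟩ := h.smul_eq (i := n + 2) (by omega)
    exact Between.of_mul hξ (h.signBalanced (by omega)).signPreserving e.symm
  · have hpos := (h.signBalanced (i := n + 3) (by omega)).abs.1 0 0
    have : (W (n + 3) 0 0 : ℝ) ≠ 0 := by exact_mod_cast abs_pos.mp hpos
    refine ⟨W (n + 3) 1 0 / W (n + 3) 0 0, ?_⟩
    simp [Between, div_mul_cancel₀ _ this]
  · exact isCompact_Icc.of_isClosed_subset (closed _)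
      fun ξ hξ => (h.signBalanced (by omega)).mem_Icc_of_between hξ

lemma isAssociated (h : IsDetFib m W) {ξ : ℝ} (hξ : ∀ i, 3 ≤ i → Between ξ (W i)) :
    IsAssociated ξ W := by
  obtain ⟨E, hE1, hE⟩ := h.exists_gamGrowth
  have hE0 : 0 < E := by linarith
  have hm : (1 : ℝ) ≤ |(m : ℝ)| := by exact_mod_cast Int.one_le_abs h.ne
  have n0 : ∀ i, 0 ≤ xiNorm ξ (W i) * mnorm (W i) := fun i =>
    mul_nonneg (xiNorm_nonneg _ _) (mnorm_nonneg _)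
  set c := 27 * |(m : ℝ)| + xiNorm ξ (W 1) * mnorm (W 1) + xiNorm ξ (W 2) * mnorm (W 2) with hc
  have hcle : ∀ i, 1 ≤ i → xiNorm ξ (W i) * mnorm (W i) ≤ c := fun i hi => by
    have h1 := n0 1
    have h2 := n0 2
    rcases (by omega : i = 1 ∨ i = 2 ∨ 3 ≤ i) with rfl | rfl | hi
    · linarith
    · linarith
    · have := (h.signBalanced (i := i) (by omega)).xiNorm_mul_mnorm_le (hξ i hi)
      linarith [h.abs_det_le (i := i) (by omega)]
  have hc0 : 0 < c := by linarith [n0 1, n0 2]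
  refine ⟨h.isFibP, h.unboundedSeq, h.admissible, E⁻¹, E, 1 / 2, c, 1, |(m : ℝ)|, by positivity,
    hE0, by norm_num, hc0, one_pos, by linarith, fun i hi => ?_⟩
  obtain ⟨p, g1, g2⟩ := hE i hi
  have p0 : 0 < mnorm (W i) := by linarith
  refine ⟨?_, g2, ?_, ?_, h.one_le_abs_det hi, h.abs_det_le hi⟩
  · rw [inv_mul_le_iff₀ hE0]
    exact g1
  · rw [← div_eq_mul_inv, div_le_iff₀ p0]
    linarith [_root_.abs_det_le ξ (W i), h.one_le_abs_det hi]
  · rw [← div_eq_mul_inv, le_div_iff₀ p0]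
    exact hcle i hi

end IsDetFib

namespace IsDetFib

variable {m : ℤ} {W : ℕ → M2}

/-- The left divisors of `Q * W_n` have upper left entries at all scales from that of `Q` on. -/
lemma exists_divisor (h : IsDetFib m W) {n : ℕ} (hn : 2 ≤ n) : ∀ {Q : M2} {X : ℤ}, IsGood m Q →
    |Q 0 0| ≤ X → X ≤ |pmul Q (W n) 0 0| →
    ∃ (M R : M2) (k : ℤ), IsGood m M ∧ k ≠ 0 ∧ SignPreserving R ∧ M * R = k • pmul Q (W n) ∧
      X ≤ |M 0 0| ∧ |M 0 0| ≤ 10 * max |W 2 0 0| |W 3 0 0| * X := by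
  have base : ∀ n, 2 ≤ n → |W n 0 0| ≤ max |W 2 0 0| |W 3 0 0| → ∀ {Q : M2} {X : ℤ},
      IsGood m Q → |Q 0 0| ≤ X → X ≤ |pmul Q (W n) 0 0| →
      ∃ (M R : M2) (k : ℤ), IsGood m M ∧ k ≠ 0 ∧ SignPreserving R ∧ M * R = k • pmul Q (W n) ∧
        X ≤ |M 0 0| ∧ |M 0 0| ≤ 10 * max |W 2 0 0| |W 3 0 0| * X := by
    intro n hn hW Q X hQ hX hX'
    refine ⟨pmul Q (W n), 1, 1, (hQ.pmul h.ne (h.isGood hn)).1, one_ne_zero, .one, by simp, hX',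
      ?_⟩
    have h1 := hQ.abs_pmul_le h.ne (h.isGood hn)
    have h2 := mul_le_mul hX hW (abs_nonneg _) ((abs_nonneg _).trans hX)
    linarith
  induction n using Nat.strong_induction_on with
  | _ n ih =>
    intro Q X hQ hX hX'
    rcases (by omega : n = 2 ∨ n = 3 ∨ 4 ≤ n) with rfl | rfl | h4
    · exact base 2 le_rfl (le_max_left _ _) hQ hX hX'
    · exact base 3 (by norm_num) (le_max_right _ _) hQ hX hX'
    · obtain ⟨n, rfl⟩ := Nat.exists_eq_add_of_le' hn
      have g0 : IsGood m (W n) := h.isGood (by omega)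
      have g1 : IsGood m (W (n + 1)) := h.isGood (by omega)
      obtain ⟨gQ, -⟩ := hQ.pmul h.ne g1
      have e : pmul Q (W (n + 2)) = pmul (pmul Q (W (n + 1))) (W n) := by
        rw [h.fib n (by omega), hQ.1.pmul_assoc h.ne g1.1 g0.1]
      rcases le_or_gt X |pmul Q (W (n + 1)) 0 0| with hle | hlt
      · obtain ⟨M, R, k, hM, hk, hR, hMR, hM'⟩ := ih (n + 1) (by omega) (by omega) hQ hX hle
        obtain ⟨-, l, hl, -, e'⟩ := gQ.pmul h.ne g0
        refine ⟨M, R * W n, k * l, hM, mul_ne_zero hk hl.ne', hR.mul g0.2.signPreserving, ?_, hM'⟩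
        rw [e, mul_smul, e', ← Matrix.mul_assoc, hMR, Matrix.smul_mul]
      · rw [e] at hX' ⊢
        exact ih n (by omega) (by omega) gQ hlt.le hX'

lemma exists_between_le (h : IsDetFib m W) {ξ : ℝ} (hξ : ∀ i, 3 ≤ i → Between ξ (W i)) {X : ℤ}
    (hX : |W 3 0 0| ≤ X) :
    ∃ M, IsGood m M ∧ Between ξ M ∧ X ≤ |M 0 0| ∧
      |M 0 0| ≤ 10 * max |W 2 0 0| |W 3 0 0| * X := by
  have hex : ∃ n, X ≤ |W (n + 4) 0 0| :=
    ⟨X.toNat, by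
      have := h.le_abs X.toNat
      have := h.abs_add_one_le (i := X.toNat + 3) (by omega)
      rw [show X.toNat + 4 = X.toNat + 3 + 1 by omega]
      omega⟩
  obtain ⟨n, hn, hn'⟩ : ∃ n, |W (n + 3) 0 0| ≤ X ∧ X ≤ |W (n + 4) 0 0| := by
    classical
    refine ⟨Nat.find hex, ?_, Nat.find_spec hex⟩
    rcases Nat.eq_zero_or_eq_succ_pred (Nat.find hex) with h0 | h0
    · rw [h0]; exact hX
    · have := Nat.find_min hex (m := (Nat.find hex).pred) (by omega)
      rw [h0]
      exact (not_le.mp this).le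
  have e := h.fib (n + 2) (by omega)
  rw [e] at hn'
  obtain ⟨M, R, k, hM, -, hR, hMR, hM'⟩ :=
    h.exists_divisor (n := n + 2) (by omega) (h.isGood (by omega)) hn hn'
  exact ⟨M, hM, (hξ (n + 4) (by omega)).of_mul hR (e ▸ hMR), hM'⟩

lemma badlyApprox (h : IsDetFib m W) {ξ : ℝ} (hξ : ∀ i, 3 ≤ i → Between ξ (W i)) :
    BadlyApprox ξ := by
  refine ⟨?_, ?_⟩
  · rintro ⟨q, rfl⟩
    refine (h.isAssociated hξ).not_quadratic 0 q.den (-q.num) (fun h0 => q.den_ne_zero ?_) ?_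
    · exact_mod_cast h0.2.1
    · have := Rat.cast_def (K := ℝ) q
      have hd : (q.den : ℝ) ≠ 0 := by exact_mod_cast q.den_ne_zero
      rw [this]
      push_cast
      field_simp
      ring
  have hm : 1 ≤ |m| := Int.one_le_abs h.ne
  set K := 10 * max |W 2 0 0| |W 3 0 0| with hK
  set Y := 6 * |m| + |W 3 0 0| with hY
  have hw3 := abs_nonneg (W 3 0 0)
  have hK0 : 0 < K := by
    have := le_max_left |W 2 0 0| |W 3 0 0|
    have := (h.signBalanced le_rfl).abs.1 0 0
    omega
  have hY0 : 0 < Y := by omega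
  have hK0' : (0 : ℝ) < K := by exact_mod_cast hK0
  have hY0' : (0 : ℝ) < Y := by exact_mod_cast hY0
  refine ⟨1 / (12 * K * Y), by positivity, fun p q hq => ?_⟩
  have hq1 : 1 ≤ |q| := Int.one_le_abs hq
  obtain ⟨M, hM, hMξ, hX, hX'⟩ := h.exists_between_le hξ (X := Y * |q|) (by nlinarith)
  obtain ⟨d1, d2⟩ := hM.2.abs_mul_abs_le hMξ
  have hdet : |(M.det : ℝ)| ≤ |(m : ℝ)| := by exact_mod_cast hM.1.abs_det_le h.ne
  have b1 : |(M 0 1 : ℝ)| ≤ 3 * |(M 0 0 : ℝ)| := by exact_mod_cast hM.2.abs.2.1 0 1 0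
  have b2 : |(M 0 0 : ℝ)| ≤ 3 * |(M 0 1 : ℝ)| := by exact_mod_cast hM.2.abs.2.1 0 0 1
  have a0 : 0 < |(M 0 0 : ℝ)| := by exact_mod_cast hM.2.abs.1 0 0
  have hq0 : (0 : ℝ) < |(q : ℝ)| := by exact_mod_cast hq1
  have hXq : 6 * |(m : ℝ)| * |(q : ℝ)| ≤ |(M 0 0 : ℝ)| := by
    have : 6 * |m| * |q| ≤ |M 0 0| := by nlinarith
    exact_mod_cast this
  have hXK : |(M 0 0 : ℝ)| ≤ K * (Y * |(q : ℝ)|) := by exact_mod_cast hX'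
  obtain ⟨j, hj⟩ : ∃ j, p * M 0 j - q * M 1 j ≠ 0 := by
    by_contra! hc
    refine hM.1.det_ne_zero h.ne (mul_left_cancel₀ hq ?_)
    rw [Matrix.det_fin_two]
    linear_combination M 0 1 * hc 0 - M 0 0 * hc 1
  have hj1 : (1 : ℝ) ≤ |(p : ℝ) * M 0 j - q * M 1 j| := by exact_mod_cast Int.one_le_abs hj
  have hMj : |(M 0 j : ℝ)| ≤ 3 * |(M 0 0 : ℝ)| := by
    fin_cases j
    · simp only [Fin.zero_eta]; linarith
    · exact b1
  have hdj : |(M 0 0 : ℝ)| * |ξ * M 0 j - M 1 j| ≤ 3 * |(m : ℝ)| := by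
    fin_cases j
    · have := mul_le_mul_of_nonneg_right b2 (abs_nonneg (ξ * M 0 0 - M 1 0))
      simp only [Fin.zero_eta]
      linarith
    · have := abs_nonneg (m : ℝ)
      simp only [Fin.mk_one]
      linarith
  set δ := |ξ - p / q| with hδ
  have hδq : |(q : ℝ) * ξ - p| = |(q : ℝ)| * δ := by
    rw [hδ, ← abs_mul]
    congr 1
    have : (q : ℝ) ≠ 0 := by exact_mod_cast hq
    field_simp
  have htri : |(p : ℝ) * M 0 j - q * M 1 j| ≤
      |(q : ℝ)| * |ξ * M 0 j - M 1 j| + |(q : ℝ)| * δ * |(M 0 j : ℝ)| := by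
    rw [← hδq, ← abs_mul, ← abs_mul]
    refine le_trans (le_of_eq ?_) (abs_sub _ _)
    congr 1
    ring
  have hfirst : |(q : ℝ)| * |ξ * M 0 j - M 1 j| ≤ 1 / 2 := by
    refine le_of_mul_le_mul_left ?_ a0
    nlinarith
  have hδ0 : 0 ≤ δ := abs_nonneg _
  have hsecond : 1 / 2 ≤ |(q : ℝ)| * δ * (3 * (K * (Y * |(q : ℝ)|))) := by
    have : |(q : ℝ)| * δ * |(M 0 j : ℝ)| ≤ |(q : ℝ)| * δ * (3 * (K * (Y * |(q : ℝ)|))) := by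
      gcongr
      linarith
    linarith
  have hq2 : (q : ℝ) ^ 2 = |(q : ℝ)| * |(q : ℝ)| := by rw [← sq_abs, sq]
  rw [hq2, div_div, div_lt_iff₀ (by positivity)]
  linarith

end IsDetFib

/-- For W₁ = (m m; m-1 m) and W₂ = (2m m; 2m-1 m), the Fibonacci sequence they generate in 𝒫
is associated to a badly approximable extremal real number ξ, det W_i = m for 3 ∤ i and
det W_i = 1 for 3 ∣ i, and if |m| is not a perfect square then ξ is not GL₂(ℚ)-conjugate to
any extremal real number with an associated Fibonacci sequence in GL₂(ℤ). -/
theorem stmt19 (m : ℤ) (hm : m ≠ 0) (W : ℕ → M2)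
    (hW1 : W 1 = !![m, m; m - 1, m]) (hW2 : W 2 = !![2 * m, m; 2 * m - 1, m])
    (hFib : ∀ i, 1 ≤ i → W (i + 2) = pmul (W (i + 1)) (W i)) :
    ∃ ξ : ℝ, IsExtremal ξ ∧ IsAssociated ξ W ∧ BadlyApprox ξ ∧
      (∀ i, 1 ≤ i → ¬ (3 ∣ i) → (W i).det = m) ∧
      (∀ i, 1 ≤ i → 3 ∣ i → (W i).det = 1) ∧
      ((¬ ∃ n : ℤ, n * n = |m|) →
        ∀ A : Matrix (Fin 2) (Fin 2) ℚ, A.det ≠ 0 →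
          ¬ HasGLAssoc (((A 0 0 : ℝ) * ξ + (A 0 1 : ℝ)) / ((A 1 0 : ℝ) * ξ + (A 1 1 : ℝ)))) := by
  have h : IsDetFib m W := ⟨hm, hW1, hW2, hFib⟩
  obtain ⟨ξ, hξ⟩ := h.exists_between
  have hA := h.isAssociated hξ
  have hm' : ∀ i, 1 ≤ i → ¬ (3 ∣ i) → (W i).det = m := fun _ hi h3 => (h.detType hi h3).1
  have h1 : ∀ i, 1 ≤ i → 3 ∣ i → (W i).det = 1 := fun _ hi h3 => (h.unitType hi h3).1
  exact ⟨ξ, hA.isExtremal, hA, h.badlyApprox hξ, hm', h1, hA.not_hasGLAssoc h1 hm'⟩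
end
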